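/- arXiv:0903.2904 — 3 statements merged into one kernel-verified Lean document; each statement's English description precedes it below -/
import Mathlib

section
/- Assume constants range over a Primcodable (computably encoded) type with computable equality, each interpreted function is computable, and each interpreted relation is computable. Then the model checking problem for PTLTL^FO is algorithmically decidable: there is a computable function which, given a history h and a closed PTLTL^FO formula φ, returns true if h ⊨ φ and false otherwise. -/
/-- Terms: variables, constants, and applications of interpreted function symbols
(function symbols are named by natural numbers). -/
inductive Tm (C : Type) : Type where
  | var : ℕ → Tm C
  | const : C → Tm C
  | func : ℕ → List (Tm C) → Tm C

/-- Evaluation of a term under an interpretation `F` of the function symbols and an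
environment (variable assignment) `ρ`. -/
def Tm.eval {C : Type} (F : ℕ → List C → C) (ρ : ℕ → C) : Tm C → C
  | .var x => ρ x
  | .const c => c
  | .func f args => F f (args.attach.map fun t => Tm.eval F ρ t.1)
  decreasing_by simp_wf; have := List.sizeOf_lt_of_mem t.2; omega

/-- Variables occurring in a term. -/
def Tm.fv {C : Type} : Tm C → List ℕ
  | .var x => [x]
  | .const _ => []
  | .func _ args => args.attach.flatMap fun t => Tm.fv t.1
  decreasing_by simp_wf; have := List.sizeOf_lt_of_mem t.2; omega

/-- PTLTL^FO formulas: uninterpreted predicate atoms, interpreted relation atoms,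
conjunction, negation, "previous" X⁻¹, "since" S, and the guarded universal
quantifier `all xs p ψ` (∀(x₁,…,xₙ):p. ψ). -/
inductive Fm (C : Type) : Type where
  | atom : ℕ → List (Tm C) → Fm C
  | rel : ℕ → List (Tm C) → Fm C
  | and : Fm C → Fm C → Fm C
  | not : Fm C → Fm C
  | prev : Fm C → Fm C
  | since : Fm C → Fm C → Fm C
  | all : List ℕ → ℕ → Fm C → Fm C

/-- Free variables of a formula. -/
def Fm.fv {C : Type} : Fm C → List ℕ
  | .atom _ ts => ts.flatMap Tm.fv
  | .rel _ ts => ts.flatMap Tm.fv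
  | .and a b => a.fv ++ b.fv
  | .not a => a.fv
  | .prev a => a.fv
  | .since a b => a.fv ++ b.fv
  | .all xs _ a => a.fv.filter (fun v => v ∉ xs)

/-- A formula is closed if it has no free variables. -/
def Fm.Closed {C : Type} (φ : Fm C) : Prop := φ.fv = []

/-- A session is a finite set of events `p(c₁,…,cₙ)`. -/
abbrev Session (C : Type) := Finset (ℕ × List C)

/-- A history is a (finite) list of sessions. -/
abbrev History (C : Type) := List (Session C)

/-- Update an environment on the list of variables `xs` with the list of values `cs`. -/
def updEnv {C : Type} (ρ : ℕ → C) (xs : List ℕ) (cs : List C) : ℕ → C :=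
  fun v => ((xs.zip cs).lookup v).getD (ρ v)

/-- The forcing relation `(h,i) ⊨ φ` (1-based session index `i`, environment `ρ`),
with interpretation `F` of function symbols and `R` of relation symbols. -/
def Sat {C : Type} (F : ℕ → List C → C) (R : ℕ → List C → Bool) (h : History C) :
    ℕ → (ℕ → C) → Fm C → Prop
  | i, ρ, .atom p ts => (p, ts.map (Tm.eval F ρ)) ∈ h.getD (i - 1) ∅
  | i, ρ, .rel r ts => R r (ts.map (Tm.eval F ρ)) = true
  | i, ρ, .and a b => Sat F R h i ρ a ∧ Sat F R h i ρ b
  | i, ρ, .not a => ¬ Sat F R h i ρ a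
  | i, ρ, .prev a => 1 < i ∧ Sat F R h (i - 1) ρ a
  | i, ρ, .since a b =>
      ∃ j, 1 ≤ j ∧ j ≤ i ∧ Sat F R h j ρ b ∧ ∀ k, j < k → k ≤ i → Sat F R h k ρ a
  | i, ρ, .all xs p a =>
      ∀ cs : List C, cs.length = xs.length → (p, cs) ∈ h.getD (i - 1) ∅ →
        Sat F R h i (updEnv ρ xs cs) a

/-- A natural-number encoding of terms. -/
def Tm.enc {C : Type} [Encodable C] : Tm C → ℕ
  | .var x => Nat.pair 0 x
  | .const c => Nat.pair 1 (Encodable.encode c)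
  | .func f args =>
      Nat.pair 2 (Nat.pair f (Encodable.encode (args.attach.map fun t => Tm.enc t.1)))
  decreasing_by simp_wf; have := List.sizeOf_lt_of_mem t.2; omega

/-- A natural-number encoding of formulas. -/
def Fm.enc {C : Type} [Encodable C] : Fm C → ℕ
  | .atom p ts => Nat.pair 0 (Nat.pair p (Encodable.encode (ts.map Tm.enc)))
  | .rel r ts => Nat.pair 1 (Nat.pair r (Encodable.encode (ts.map Tm.enc)))
  | .and a b => Nat.pair 2 (Nat.pair a.enc b.enc)
  | .not a => Nat.pair 3 a.enc
  | .prev a => Nat.pair 4 a.enc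
  | .since a b => Nat.pair 5 (Nat.pair a.enc b.enc)
  | .all xs p a => Nat.pair 6 (Nat.pair (Encodable.encode xs) (Nat.pair p a.enc))


namespace MC
open Encodable

section comb
variable {α β σ : Type} [Primcodable α] [Primcodable β] [Primcodable σ]

theorem cMap {f : α → List β} {g : α → β → σ} (hf : Computable f) (hg : Computable₂ g) :
    Computable fun a => (f a).map (g a) := by
  have key : Computable fun a => Nat.rec (motive := fun _ => List σ) []
      (fun k acc => acc ++ (((f a)[k]?).map (g a)).toList) (f a).length := by
    refine Computable.nat_rec (h := fun a (p : ℕ × List σ) =>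
      p.2 ++ (((f a)[p.1]?).map (g a)).toList) (Computable.list_length.comp hf)
      (Computable.const []) ?_
    refine Computable.list_append.comp (Computable.snd.comp Computable.snd) ?_
    refine Primrec.optionToList.to_comp.comp ?_
    refine Computable.option_map
      (Computable.list_getElem?.comp (hf.comp Computable.fst) (Computable.fst.comp Computable.snd)) ?_
    exact hg.comp (Computable.fst.comp Computable.fst) Computable.snd
  refine key.of_eq fun a => ?_
  have : ∀ k, Nat.rec (motive := fun _ => List σ) []
      (fun k acc => acc ++ (((f a)[k]?).map (g a)).toList) k = ((f a).take k).map (g a) := by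
    intro k
    induction k with
    | zero => simp
    | succ k ih =>
      show _ ++ _ = _
      rw [ih, List.take_add_one]
      cases h : (f a)[k]? <;> simp
  rw [this, List.take_length]

theorem cFilter {f : α → List β} {g : α → β → Bool} (hf : Computable f) (hg : Computable₂ g) :
    Computable fun a => (f a).filter (g a) := by
  have : Computable fun a => ((f a).map (fun b => cond (g a b) [b] [])).flatten := by
    refine Primrec.list_flatten.to_comp.comp (cMap hf ?_)
    exact Computable.cond hg (Computable.list_cons.comp Computable.snd (Computable.const []))
      (Computable.const [])
  refine this.of_eq fun a => ?_
  induction f a with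
  | nil => rfl
  | cons x l ih =>
    cases h : g a x <;> simp [h] at ih ⊢ <;> exact ih

theorem cEq [DecidableEq β] {f g : α → β} (hf : Computable f) (hg : Computable g) :
    Computable fun a => decide (f a = g a) :=
  (Primrec.eq (α := β)).decide.to_comp.comp hf hg

theorem cLt {f g : α → ℕ} (hf : Computable f) (hg : Computable g) :
    Computable fun a => decide (f a < g a) :=
  (Primrec.nat_lt).decide.to_comp.comp hf hg

theorem cNot {f : α → Bool} (hf : Computable f) : Computable fun a => !(f a) :=
  Primrec.not.to_comp.comp hf

theorem cAnd {f g : α → Bool} (hf : Computable f) (hg : Computable g) :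
    Computable fun a => (f a && g a) := Primrec.and.to_comp.comp hf hg

theorem cOr {f g : α → Bool} (hf : Computable f) (hg : Computable g) :
    Computable fun a => (f a || g a) := Primrec.or.to_comp.comp hf hg

theorem cMem {f : α → β} {g : α → List β} [D : ∀ a, Decidable (f a ∈ g a)] (hf : Computable f)
    (hg : Computable g) : Computable fun a => decide (f a ∈ g a) := by
  letI := decidableEqOfEncodable β
  have := cLt (Primrec.list_idxOf.to_comp.comp hf hg : Computable fun a => (g a).idxOf (f a)) 
    (Computable.list_length.comp hg)
  refine this.of_eq fun a => ?_
  simp [List.idxOf_lt_length_iff]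

theorem cAny {f : α → List β} {g : α → β → Bool} (hf : Computable f) (hg : Computable₂ g) :
    Computable fun a => (f a).any (g a) := by
  refine (cMem (Computable.const true) (cMap hf hg)).of_eq fun a => ?_
  rw [Bool.eq_iff_iff]; simp

theorem cAll {f : α → List β} {g : α → β → Bool} (hf : Computable f) (hg : Computable₂ g) :
    Computable fun a => (f a).all (g a) := by
  refine (cNot (cAny hf (g := fun a b => !(g a b)) (cNot hg))).of_eq fun a => ?_
  rw [List.all_eq_not_any_not]

theorem cGetD {f : α → List β} {g : α → ℕ} (d : β) (hf : Computable f) (hg : Computable g) :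
    Computable fun a => (f a).getD (g a) d := (Primrec.list_getD d).to_comp.comp hf hg

theorem cU1 {f : α → ℕ} (hf : Computable f) : Computable fun a => (f a).unpair.1 :=
  Computable.fst.comp (Computable.unpair.comp hf)

theorem cU2 {f : α → ℕ} (hf : Computable f) : Computable fun a => (f a).unpair.2 :=
  Computable.snd.comp (Computable.unpair.comp hf)

theorem cDec {f : α → ℕ} (d : β) (hf : Computable f) :
    Computable fun a => (decode (α := β) (f a)).getD d :=
  Computable.option_getD (Computable.decode.comp hf) (Computable.const d)

/-- Course-of-values recursion. -/
theorem cRec (G : α → List σ → σ) (hG : Computable₂ G) :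
    ∃ f : α → ℕ → σ, Computable₂ f ∧ ∀ a n, f a n = G a ((List.range n).map (f a)) := by
  let L : α → ℕ → List σ := fun a n => Nat.rec [] (fun _ l => l ++ [G a l]) n
  have hL : ∀ a n, L a n = (List.range n).map (fun n => G a (L a n)) := by
    intro a n
    induction n with
    | zero => rfl
    | succ n ih =>
      rw [List.range_succ, List.map_append, ← ih]; rfl
  have hf : ∀ a n, G a (L a n) = G a ((List.range n).map (fun n => G a (L a n))) := by
    intro a n; rw [← hL]
  refine ⟨fun a n => G a (L a n), ?_, hf⟩
  refine Computable.nat_strong_rec _ (g := fun a l => some (G a l))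
    (Computable.option_some.comp hG) ?_
  intro a n; rw [← hf]

end comb

/-! ### codes -/

theorem lt_pair_right {a b : ℕ} (h : 0 < a) : b < Nat.pair a b := by
  unfold Nat.pair; split <;> nlinarith

theorem mem_lt_encode {l : List ℕ} {m : ℕ} (h : m ∈ l) : m < encode l := by
  induction l with
  | nil => simp at h
  | cons x l ih =>
    rw [encode_list_cons]
    rcases List.mem_cons.1 h with rfl | h
    · exact Nat.lt_succ_of_le (Nat.left_le_pair _ _)
    · exact Nat.lt_succ_of_le ((ih h).le.trans (Nat.right_le_pair _ _))

theorem getD_tab {σ : Type} (f : ℕ → σ) (d : σ) {m n : ℕ} (h : m < n) :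
    ((List.range n).map f).getD m d = f m := by
  simp [h]

section terms
variable {C : Type} [Primcodable C] (F : ℕ → List C → C) (c0 : C)

def ev (env : List C) : ℕ → C := fun x => env.getD x c0

theorem exists_T (hF : Computable fun q : ℕ × List C => F q.1 q.2) :
    ∃ T : List C → ℕ → C, Computable₂ T ∧
      ∀ env (t : Tm C), T env t.enc = t.eval F (ev c0 env) := by
  let G : List C → List C → C := fun env L =>
    cond (decide (L.length.unpair.1 = 0)) (env.getD L.length.unpair.2 c0)
    (cond (decide (L.length.unpair.1 = 1)) ((decode (α := C) L.length.unpair.2).getD c0)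
      (F L.length.unpair.2.unpair.1
        (((decode (α := List ℕ) L.length.unpair.2.unpair.2).getD []).map
          fun m => L.getD m c0)))
  have hn : Computable fun p : List C × List C => p.2.length :=
    Computable.list_length.comp Computable.snd
  have hG : Computable₂ G := by
    refine Computable.cond (cEq (cU1 hn) (Computable.const 0))
      (cGetD _ Computable.fst (cU2 hn)) ?_
    refine Computable.cond (cEq (cU1 hn) (Computable.const 1)) (cDec _ (cU2 hn)) ?_
    have h1 : Computable fun p : List C × List C =>
        (((decode (α := List ℕ) p.2.length.unpair.2.unpair.2).getD []).map
          fun m => p.2.getD m c0) :=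
      cMap (cDec _ (cU2 (cU2 hn))) (cGetD _ (Computable.snd.comp Computable.fst) Computable.snd)
    have h2 : Computable fun p : List C × List C => p.2.length.unpair.2.unpair.1 := cU1 (cU2 hn)
    have hF' : Computable₂ F := hF
    exact hF'.comp h2 h1
  obtain ⟨T, hT, hrec⟩ := cRec G hG
  refine ⟨T, hT, fun env t => ?_⟩
  induction t using Tm.enc.induct with
  | case1 x => rw [hrec]; simp [G, Tm.enc, Tm.eval, ev]
  | case2 c => rw [hrec]; simp [G, Tm.enc, Tm.eval]
  | case3 f args ih =>
    rw [hrec]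
    simp only [G, Tm.enc, Tm.eval, List.length_map, List.length_range, Nat.unpair_pair, encodek]
    simp only [Option.getD_some, List.map_map]
    simp only [show (decide (2 = 0)) = false from rfl, show (decide (2 = 1)) = false from rfl, cond_false]
    congr 1
    apply List.map_congr_left
    intro t ht
    simp only [Function.comp]
    rw [← ih t]
    have : t.1.enc < Nat.pair 2 (Nat.pair f (encode (args.attach.map fun t => Tm.enc t.1))) := by
      refine lt_of_lt_of_le ?_ (Nat.right_le_pair _ _)
      refine lt_of_lt_of_le ?_ (Nat.right_le_pair _ _)
      exact mem_lt_encode (List.mem_map.2 ⟨t, ht, rfl⟩)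
    exact getD_tab _ _ this

end terms

section envs
variable {C : Type}

/-- all lists of length `k` over `A` -/
def envs (A : List C) (k : ℕ) : List (List C) :=
  Nat.rec [[]] (fun _ E => E.flatMap fun e => A.map fun c => c :: e) k

theorem mem_envs (A : List C) (k : ℕ) (e : List C) :
    e ∈ envs A k ↔ e.length = k ∧ ∀ c ∈ e, c ∈ A := by
  induction k generalizing e with
  | zero => simp [envs]; rintro rfl; simp
  | succ k ih =>
    show e ∈ (envs A k).flatMap _ ↔ _
    simp only [List.mem_flatMap, ih, List.mem_map]
    constructor
    · rintro ⟨e', ⟨h1, h2⟩, c, hc, rfl⟩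
      simp [h1, hc]; exact h2
    · rintro ⟨h1, h2⟩
      cases e with
      | nil => simp at h1
      | cons c e =>
        simp at h1 h2
        exact ⟨e, ⟨h1, h2.2⟩, c, h2.1, rfl⟩

abbrev Hs (C : Type) := List (List (ℕ × List C))

def dom (c0 : C) (h : Hs C) : List C := c0 :: h.flatten.flatMap Prod.snd

def univ (c0 : C) (a : Hs C × ℕ) : List (ℕ × List C) :=
  (List.range (a.1.length + 1)).flatMap fun i => (envs (dom c0 a.1) a.2).map fun e => (i, e)

theorem mem_univ (c0 : C) (a : Hs C × ℕ) (i : ℕ) (e : List C) :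
    (i, e) ∈ univ c0 a ↔ i ≤ a.1.length ∧ e.length = a.2 ∧ ∀ c ∈ e, c ∈ dom c0 a.1 := by
  simp [univ, mem_envs]

variable [Primcodable C]

theorem univ_primrec (c0 : C) : Primrec (univ c0) := by
  have hd : Primrec fun h : Hs C => dom c0 h :=
    Primrec.list_cons.comp (Primrec.const c0)
      (Primrec.list_flatMap Primrec.list_flatten (Primrec.snd.comp Primrec.snd))
  have he : Primrec fun a : Hs C × ℕ => envs (dom c0 a.1) a.2 := by
    refine Primrec.nat_rec' (h := fun (a : Hs C × ℕ) (p : ℕ × List (List C)) =>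
      p.2.flatMap fun e => (dom c0 a.1).map fun c => c :: e) Primrec.snd (Primrec.const [[]]) ?_
    refine Primrec.list_flatMap (Primrec.snd.comp Primrec.snd) ?_
    refine Primrec.list_map (hd.comp (Primrec.fst.comp (Primrec.fst.comp Primrec.fst))) ?_
    exact Primrec.list_cons.comp Primrec.snd (Primrec.snd.comp Primrec.fst)
  refine Primrec.list_flatMap (Primrec.list_range.comp
    (Primrec.succ.comp (Primrec.list_length.comp Primrec.fst))) ?_
  refine Primrec.list_map (he.comp Primrec.fst) ?_
  exact Primrec.pair (Primrec.snd.comp Primrec.fst) Primrec.snd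

def updL (c0 : C) (N : ℕ) (env : List C) (xs : List ℕ) (cs : List C) : List C :=
  (List.range N).map fun v => (cs[xs.idxOf v]?).getD (env.getD v c0)

theorem lookup_zip {xs : List ℕ} {cs : List C} (h : cs.length = xs.length) (v : ℕ) :
    (xs.zip cs).lookup v = cs[xs.idxOf v]? := by
  induction xs generalizing cs with
  | nil => simp at h; simp [h]
  | cons x xs ih =>
    cases cs with
    | nil => simp at h
    | cons c cs =>
      simp at h
      by_cases hv : v = x
      · subst hv; simp [List.lookup]
      · have : (v == x) = false := by simpa using hv
        have h2 : x ≠ v := fun h => hv h.symm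
        simp [List.lookup, this, ih h, List.idxOf_cons_ne _ h2]

theorem ev_updL {c0 : C} {N : ℕ} {env : List C} {xs : List ℕ} {cs : List C}
    (h : cs.length = xs.length) (hN : env.length = N) (hx : ∀ x ∈ xs, x < N) :
    ev c0 (updL c0 N env xs cs) = updEnv (ev c0 env) xs cs := by
  funext v
  rw [updEnv, lookup_zip h]
  by_cases hv : v < N
  · simp [ev, updL, hv]
  · have h1 : v ∉ xs := fun h => hv (hx v h)
    have h2 : xs.idxOf v = xs.length := List.idxOf_eq_length h1
    have h3 : env.length ≤ v := by omega
    simp [ev, updL, hv, h2, ← h, h3]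

theorem updL_mem {c0 : C} {N : ℕ} {env : List C} {xs : List ℕ} {cs A : List C}
    (h0 : c0 ∈ A) (h1 : ∀ c ∈ env, c ∈ A) (h2 : ∀ c ∈ cs, c ∈ A) :
    ∀ c ∈ updL c0 N env xs cs, c ∈ A := by
  intro c hc
  simp only [updL, List.mem_map] at hc
  obtain ⟨v, -, rfl⟩ := hc
  cases h : cs[xs.idxOf v]? with
  | some d => exact h2 _ (List.mem_of_getElem? h)
  | none =>
    rw [Option.getD_none, List.getD_eq_getElem?_getD]
    cases h' : env[v]? with
    | none => exact h0
    | some d => exact h1 _ (List.mem_of_getElem? h')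

theorem cUpd {α : Type} [Primcodable α] (c0 : C) {N : α → ℕ} {env : α → List C}
    {xs : α → List ℕ} {cs : α → List C} (hN : Computable N) (henv : Computable env)
    (hxs : Computable xs) (hcs : Computable cs) :
    Computable fun a => updL c0 (N a) (env a) (xs a) (cs a) := by
  refine cMap (Primrec.list_range.to_comp.comp hN) ?_
  refine Computable.option_getD (Computable.list_getElem?.comp (hcs.comp Computable.fst) ?_)
    (cGetD _ (henv.comp Computable.fst) Computable.snd)
  exact Primrec.list_idxOf.to_comp.comp Computable.snd (hxs.comp Computable.fst)

end envs

section formulas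
variable {C : Type} [Primcodable C] [DecidableEq C]
  (R : ℕ → List C → Bool) (c0 : C) (T : List C → ℕ → C)

abbrev Tab (C : Type) := List (List (ℕ × List C))

/-- evaluation context: ((history, number of variables), table of subresults), (index, env) -/
abbrev Ctx (C : Type) := ((Hs C × ℕ) × Tab C) × (ℕ × List C)

/-- payload of the code under consideration -/
def pay (x : Ctx C) : ℕ := x.1.2.length.unpair.2

def look (x : Ctx C) (m i : ℕ) (env : List C) : Bool := decide ((i, env) ∈ x.1.2.getD m [])

def tms (n : ℕ) : List ℕ := (decode (α := List ℕ) n).getD []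

def bAtom (x : Ctx C) : Bool :=
  decide (((pay x).unpair.1, (tms (pay x).unpair.2).map (T x.2.2)) ∈
    x.1.1.1.getD (x.2.1 - 1) [])

def bRel (x : Ctx C) : Bool :=
  R (pay x).unpair.1 ((tms (pay x).unpair.2).map (T x.2.2))

def bAnd (x : Ctx C) : Bool :=
  look x (pay x).unpair.1 x.2.1 x.2.2 && look x (pay x).unpair.2 x.2.1 x.2.2

def bNot (x : Ctx C) : Bool := !(look x (pay x) x.2.1 x.2.2)

def bPrev (x : Ctx C) : Bool := decide (1 < x.2.1) && look x (pay x) (x.2.1 - 1) x.2.2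

def bSince (x : Ctx C) : Bool :=
  (List.range (x.2.1 + 1)).any fun j =>
    decide (0 < j) && (look x (pay x).unpair.2 j x.2.2 &&
      (List.range (x.2.1 + 1)).all fun k =>
        !(decide (j < k)) || look x (pay x).unpair.1 k x.2.2)

def bAll (x : Ctx C) : Bool :=
  (x.1.1.1.getD (x.2.1 - 1) []).all fun e =>
    !(decide (e.1 = (pay x).unpair.2.unpair.1)) ||
    (!(decide (e.2.length = (tms (pay x).unpair.1).length)) ||
      look x (pay x).unpair.2.unpair.2 x.2.1
        (updL c0 x.1.1.2 x.2.2 (tms (pay x).unpair.1) e.2))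

def body (x : Ctx C) : Bool :=
  cond (decide (x.1.2.length.unpair.1 = 0)) (bAtom T x)
  (cond (decide (x.1.2.length.unpair.1 = 1)) (bRel R T x)
  (cond (decide (x.1.2.length.unpair.1 = 2)) (bAnd x)
  (cond (decide (x.1.2.length.unpair.1 = 3)) (bNot x)
  (cond (decide (x.1.2.length.unpair.1 = 4)) (bPrev x)
  (cond (decide (x.1.2.length.unpair.1 = 5)) (bSince x) (bAll c0 x))))))

section comp
variable {α : Type} [Primcodable α]

theorem cIdx : Computable fun x : Ctx C => x.2.1 := Computable.fst.comp Computable.snd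
theorem cEnv : Computable fun x : Ctx C => x.2.2 := Computable.snd.comp Computable.snd
theorem cHs : Computable fun x : Ctx C => x.1.1.1 :=
  Computable.fst.comp (Computable.fst.comp Computable.fst)
theorem cN : Computable fun x : Ctx C => x.1.1.2 :=
  Computable.snd.comp (Computable.fst.comp Computable.fst)
theorem cTab : Computable fun x : Ctx C => x.1.2 := Computable.snd.comp Computable.fst
theorem cTag : Computable fun x : Ctx C => x.1.2.length.unpair.1 :=
  cU1 (Computable.list_length.comp cTab)
theorem cPay : Computable (pay : Ctx C → ℕ) := cU2 (Computable.list_length.comp cTab)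
theorem cPred {f : α → ℕ} (hf : Computable f) : Computable fun a => f a - 1 :=
  Computable.pred.comp hf
theorem cSes : Computable fun x : Ctx C => x.1.1.1.getD (x.2.1 - 1) [] :=
  cGetD _ cHs (cPred cIdx)
theorem cTms {f : α → ℕ} (hf : Computable f) : Computable fun a => tms (f a) := cDec _ hf

theorem cLook {x : α → Ctx C} {m i : α → ℕ} {env : α → List C} (hx : Computable x)
    (hm : Computable m) (hi : Computable i) (he : Computable env) :
    Computable fun a => look (x a) (m a) (i a) (env a) :=
  cMem (Computable.pair hi he) (cGetD [] (cTab.comp hx) hm)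

variable {T}
theorem cArgs (hT : Computable₂ T) :
    Computable fun x : Ctx C => (tms (pay x).unpair.2).map (T x.2.2) :=
  cMap (cTms (cU2 cPay)) (hT.comp (cEnv.comp Computable.fst) Computable.snd)

theorem cBody (hT : Computable₂ T) (hR : Computable₂ R) : Computable (body R c0 T) := by
  have hAtom : Computable (bAtom T) := cMem (Computable.pair (cU1 cPay) (cArgs hT)) cSes
  have hRel : Computable (bRel R T) := hR.comp (cU1 cPay) (cArgs hT)
  have hAnd : Computable (bAnd (C := C)) :=
    cAnd (cLook Computable.id (cU1 cPay) cIdx cEnv) (cLook Computable.id (cU2 cPay) cIdx cEnv)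
  have hNot : Computable (bNot (C := C)) := cNot (cLook Computable.id cPay cIdx cEnv)
  have hPrev : Computable (bPrev (C := C)) :=
    cAnd (cLt (Computable.const 1) cIdx) (cLook Computable.id cPay (cPred cIdx) cEnv)
  have hrange : Computable fun x : Ctx C => List.range (x.2.1 + 1) :=
    Primrec.list_range.to_comp.comp (Computable.succ.comp cIdx)
  have hSince : Computable (bSince (C := C)) := by
    refine cAny hrange ?_
    refine cAnd (cLt (Computable.const 0) Computable.snd) (cAnd ?_ ?_)
    · exact cLook Computable.fst (cU2 (cPay.comp Computable.fst)) Computable.snd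
        (cEnv.comp Computable.fst)
    · refine cAll (hrange.comp Computable.fst) ?_
      refine cOr (cNot (cLt (Computable.snd.comp Computable.fst) Computable.snd)) ?_
      exact cLook (Computable.fst.comp Computable.fst)
        (cU1 (cPay.comp (Computable.fst.comp Computable.fst))) Computable.snd
        (cEnv.comp (Computable.fst.comp Computable.fst))
  have hAll : Computable (bAll (C := C) c0) := by
    refine cAll cSes ?_
    have hp : Computable fun p : Ctx C × (ℕ × List C) => pay p.1 := cPay.comp Computable.fst
    have hxs : Computable fun p : Ctx C × (ℕ × List C) => tms (pay p.1).unpair.1 := cTms (cU1 hp)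
    have hcs : Computable fun p : Ctx C × (ℕ × List C) => p.2.2 :=
      Computable.snd.comp Computable.snd
    refine cOr (cNot (cEq (Computable.fst.comp Computable.snd) (cU1 (cU2 hp)))) ?_
    refine cOr (cNot (cEq (Computable.list_length.comp hcs) (Computable.list_length.comp hxs))) ?_
    exact cLook Computable.fst (cU2 (cU2 hp)) (cIdx.comp Computable.fst)
      (cUpd c0 (cN.comp Computable.fst) (cEnv.comp Computable.fst) hxs hcs)
  exact Computable.cond (cEq cTag (Computable.const 0)) hAtom
    (Computable.cond (cEq cTag (Computable.const 1)) hRel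
    (Computable.cond (cEq cTag (Computable.const 2)) hAnd
    (Computable.cond (cEq cTag (Computable.const 3)) hNot
    (Computable.cond (cEq cTag (Computable.const 4)) hPrev
    (Computable.cond (cEq cTag (Computable.const 5)) hSince hAll)))))

end comp

theorem look_tab {a : Hs C × ℕ} {S : ℕ → List (ℕ × List C)} {n : ℕ} {u : ℕ × List C} {m i : ℕ}
    {env : List C} (h : m < n) :
    look ((a, (List.range n).map S), u) m i env = true ↔ (i, env) ∈ S m := by
  rw [look, getD_tab _ _ h, decide_eq_true_iff]

theorem tms_encode (l : List ℕ) : tms (encode l) = l := by simp [tms]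

theorem correct (F : ℕ → List C → C) (h : History C) (hs : Hs C) (N : ℕ)
    (hlen : hs.length = h.length)
    (hmem : ∀ k e, e ∈ hs.getD k [] ↔ e ∈ h.getD k ∅)
    (hT : ∀ env (t : Tm C), T env t.enc = t.eval F (ev c0 env))
    (S : ℕ → List (ℕ × List C))
    (hS : ∀ n, S n = (univ c0 (hs, N)).filter
      fun u => body R c0 T (((hs, N), (List.range n).map S), u))
    (φ : Fm C) (hφ : φ.enc < N) (i : ℕ) (env : List C) (hu : (i, env) ∈ univ c0 (hs, N)) :
    (i, env) ∈ S φ.enc ↔ Sat F R h i (ev c0 env) φ := by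
  have hargs : ∀ (env : List C) (ts : List (Tm C)), (ts.map Tm.enc).map (T env)
      = ts.map (Tm.eval F (ev c0 env)) := by
    intro env ts
    rw [List.map_map]
    exact List.map_congr_left fun t _ => hT env t
  have hS' : ∀ n i env, (i, env) ∈ univ c0 (hs, N) → ((i, env) ∈ S n ↔
      body R c0 T (((hs, N), (List.range n).map S), (i, env)) = true) := by
    intro n i env hu
    conv_lhs => rw [hS]
    simp [hu]
  induction φ generalizing i env with
  | atom p ts =>
    rw [hS' _ _ _ hu]
    have := hmem (i - 1) (p, ts.map (Tm.eval F (ev c0 env)))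
    simpa [body, bAtom, pay, Fm.enc, Sat, tms_encode, hargs] using this
  | rel r ts =>
    rw [hS' _ _ _ hu]
    simp [body, bRel, pay, Fm.enc, Sat, tms_encode, hargs]
  | and a b iha ihb =>
    have h2 : Nat.pair a.enc b.enc < Fm.enc (.and a b) := lt_pair_right (by norm_num)
    have h3 : a.enc < Fm.enc (.and a b) := (Nat.left_le_pair _ _).trans_lt h2
    have h4 : b.enc < Fm.enc (.and a b) := (Nat.right_le_pair _ _).trans_lt h2
    have e : Fm.enc (.and a b) = Nat.pair 2 (Nat.pair a.enc b.enc) := rfl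
    rw [hS' _ _ _ hu, Sat, ← propext (iha (h3.trans hφ) _ _ hu), ← propext (ihb (h4.trans hφ) _ _ hu),
      ← look_tab h3 (a := (hs, N)) (u := (i, env)), ← look_tab h4 (a := (hs, N)) (u := (i, env))]
    simp [body, bAnd, pay, e]
  | not a iha =>
    have h3 : a.enc < Fm.enc (.not a) := lt_pair_right (by norm_num)
    have e : Fm.enc (.not a) = Nat.pair 3 a.enc := rfl
    rw [hS' _ _ _ hu, Sat, ← propext (iha (h3.trans hφ) _ _ hu),
      ← look_tab h3 (a := (hs, N)) (u := (i, env))]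
    simp [body, bNot, pay, e]
  | prev a iha =>
    have h3 : a.enc < Fm.enc (.prev a) := lt_pair_right (by norm_num)
    have e : Fm.enc (.prev a) = Nat.pair 4 a.enc := rfl
    have hu' : (i - 1, env) ∈ univ c0 (hs, N) := by
      rw [mem_univ] at hu ⊢; exact ⟨(Nat.sub_le _ _).trans hu.1, hu.2⟩
    rw [hS' _ _ _ hu, Sat, ← propext (iha (h3.trans hφ) _ _ hu'),
      ← look_tab h3 (a := (hs, N)) (u := (i, env))]
    simp [body, bPrev, pay, e]
  | since a b iha ihb =>
    have h2 : Nat.pair a.enc b.enc < Fm.enc (.since a b) := lt_pair_right (by norm_num)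
    have h3 : a.enc < Fm.enc (.since a b) := (Nat.left_le_pair _ _).trans_lt h2
    have h4 : b.enc < Fm.enc (.since a b) := (Nat.right_le_pair _ _).trans_lt h2
    have e : Fm.enc (.since a b) = Nat.pair 5 (Nat.pair a.enc b.enc) := rfl
    have hu' : ∀ j ≤ i, (j, env) ∈ univ c0 (hs, N) := by
      intro j hj
      rw [mem_univ] at hu ⊢; exact ⟨hj.trans hu.1, hu.2⟩
    have ia : ∀ j ≤ i, look (((hs, N), (List.range (Fm.enc (.since a b))).map S), (i, env))
        a.enc j env = true ↔ Sat F R h j (ev c0 env) a := fun j hj => by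
      rw [look_tab h3, propext (iha (h3.trans hφ) _ _ (hu' j hj))]
    have ib : ∀ j ≤ i, look (((hs, N), (List.range (Fm.enc (.since a b))).map S), (i, env))
        b.enc j env = true ↔ Sat F R h j (ev c0 env) b := fun j hj => by
      rw [look_tab h4, propext (ihb (h4.trans hφ) _ _ (hu' j hj))]
    rw [hS' _ _ _ hu, Sat]
    have hb : body R c0 T (((hs, N), (List.range (Fm.enc (.since a b))).map S), (i, env))
        = bSince (((hs, N), (List.range (Fm.enc (.since a b))).map S), (i, env)) := by
      simp [body, e]
    have hp : pay (((hs, N), (List.range (Fm.enc (.since a b))).map S), (i, env))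
        = Nat.pair a.enc b.enc := by simp [pay, e]
    rw [hb, bSince, hp]
    simp only [Nat.unpair_pair, List.any_eq_true, List.all_eq_true, List.mem_range,
      Bool.and_eq_true, Bool.or_eq_true, decide_eq_true_iff, Bool.not_eq_true', decide_eq_false_iff_not,
      Nat.lt_succ_iff]
    constructor
    · rintro ⟨j, hj, h0, hb, ha⟩
      exact ⟨j, h0, hj, (ib j hj).1 hb, fun k hk hki =>
        (ia k hki).1 ((ha k hki).resolve_left (not_not.2 hk))⟩
    · rintro ⟨j, h0, hj, hb, ha⟩
      refine ⟨j, hj, h0, (ib j hj).2 hb, fun k hki => ?_⟩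
      by_cases hk : j < k
      · exact Or.inr ((ia k hki).2 (ha k hk hki))
      · exact Or.inl hk
  | all xs p a iha =>
    have e : Fm.enc (.all xs p a)
      = Nat.pair 6 (Nat.pair (encode xs) (Nat.pair p a.enc)) := rfl
    have h2 : Nat.pair (encode xs) (Nat.pair p a.enc) < Fm.enc (.all xs p a) :=
      lt_pair_right (by norm_num)
    have h3 : a.enc < Fm.enc (.all xs p a) :=
      ((Nat.right_le_pair _ _).trans (Nat.right_le_pair _ _)).trans_lt h2
    have hx : ∀ x ∈ xs, x < N := fun x hx =>
      (mem_lt_encode hx).trans (((Nat.left_le_pair _ _).trans_lt h2).trans hφ)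
    rw [hS' _ _ _ hu, Sat]
    have hb : body R c0 T (((hs, N), (List.range (Fm.enc (.all xs p a))).map S), (i, env))
        = bAll c0 (((hs, N), (List.range (Fm.enc (.all xs p a))).map S), (i, env)) := by
      simp [body, e]
    have hp : pay (((hs, N), (List.range (Fm.enc (.all xs p a))).map S), (i, env))
        = Nat.pair (encode xs) (Nat.pair p a.enc) := by simp [pay, e]
    obtain ⟨u1, u2, u3⟩ := (mem_univ _ _ _ _).1 hu
    have ia : ∀ cs : List C, cs.length = xs.length → (p, cs) ∈ hs.getD (i - 1) [] →
        (look (((hs, N), (List.range (Fm.enc (.all xs p a))).map S), (i, env)) a.enc i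
          (updL c0 N env xs cs) = true ↔ Sat F R h i (updEnv (ev c0 env) xs cs) a) := by
      intro cs hcs hmem
      suffices hu' : (i, updL c0 N env xs cs) ∈ univ c0 (hs, N) by
        rw [look_tab h3, propext (iha (h3.trans hφ) _ _ hu'), ev_updL hcs u2 hx]
      rw [mem_univ]
      refine ⟨u1, by simp [updL], updL_mem (by simp [dom]) u3 ?_⟩
      intro c hc
      refine List.mem_cons_of_mem _ (List.mem_flatMap.2 ⟨(p, cs), ?_, hc⟩)
      rw [List.getD_eq_getElem?_getD] at hmem
      cases hh : hs[i - 1]? with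
      | none => simp [hh] at hmem
      | some s =>
        rw [hh] at hmem
        exact List.mem_flatten.2 ⟨s, List.mem_of_getElem? hh, hmem⟩
    rw [hb, bAll, hp]
    simp only [Nat.unpair_pair, List.all_eq_true, tms_encode,
      Bool.or_eq_true, Bool.not_eq_true', decide_eq_false_iff_not, ← hmem]
    constructor
    · intro H cs hcs hm
      rcases H _ hm with h | h | h
      · exact absurd rfl h
      · exact absurd hcs h
      · exact (ia cs hcs hm).1 h
    · rintro H ⟨q, cs⟩ hm
      by_cases hq : q = p
      · subst hq
        by_cases hcs : cs.length = xs.length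
        · exact Or.inr (Or.inr ((ia cs hcs hm).2 (H cs hcs hm)))
        · exact Or.inr (Or.inl hcs)
      · exact Or.inl hq

end formulas

section closed
variable {C : Type} (F : ℕ → List C → C) (R : ℕ → List C → Bool)

theorem eval_congr (t : Tm C) (ρ ρ' : ℕ → C) (h : ∀ x ∈ t.fv, ρ x = ρ' x) :
    t.eval F ρ = t.eval F ρ' := by
  induction t using Tm.fv.induct with
  | case1 x => simpa [Tm.eval, Tm.fv] using h
  | case2 c => simp [Tm.eval]
  | case3 f args ih =>
    rw [Tm.eval, Tm.eval]
    congr 1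
    apply List.map_congr_left
    intro t ht
    refine ih t fun x hx => h x ?_
    rw [Tm.fv]
    exact List.mem_flatMap.2 ⟨t, ht, hx⟩

theorem args_congr (ts : List (Tm C)) (ρ ρ' : ℕ → C)
    (h : ∀ x ∈ ts.flatMap Tm.fv, ρ x = ρ' x) :
    ts.map (Tm.eval F ρ) = ts.map (Tm.eval F ρ') :=
  List.map_congr_left fun t ht => eval_congr F t ρ ρ' fun x hx =>
    h x (List.mem_flatMap.2 ⟨t, ht, hx⟩)

theorem sat_congr (hh : History C) (φ : Fm C) (i : ℕ) (ρ ρ' : ℕ → C)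
    (h : ∀ x ∈ φ.fv, ρ x = ρ' x) : Sat F R hh i ρ φ ↔ Sat F R hh i ρ' φ := by
  induction φ generalizing i ρ ρ' with
  | atom p ts => rw [Sat, Sat, args_congr F ts ρ ρ' h]
  | rel p ts => rw [Sat, Sat, args_congr F ts ρ ρ' h]
  | and a b iha ihb =>
    simp only [Fm.fv, List.mem_append] at h
    rw [Sat, Sat, iha i ρ ρ' fun x hx => h x (Or.inl hx), ihb i ρ ρ' fun x hx => h x (Or.inr hx)]
  | not a iha => rw [Sat, Sat, iha i ρ ρ' h]
  | prev a iha => rw [Sat, Sat, iha _ ρ ρ' h]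
  | since a b iha ihb =>
    simp only [Fm.fv, List.mem_append] at h
    have ea := fun k => iha k ρ ρ' fun x hx => h x (Or.inl hx)
    have eb := fun k => ihb k ρ ρ' fun x hx => h x (Or.inr hx)
    simp only [Sat, ea, eb]
  | all xs p a iha =>
    rw [Sat, Sat]
    refine forall_congr' fun cs => forall_congr' fun hcs => forall_congr' fun _ => ?_
    refine iha _ _ _ fun x hx => ?_
    rw [updEnv, updEnv]
    by_cases hxs : x ∈ xs
    · have : ((xs.zip cs).lookup x).isSome := by
        rw [List.lookup_isSome_iff]
        obtain ⟨k, hk, rfl⟩ := List.getElem_of_mem hxs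
        refine ⟨(xs[k], cs[k]), ?_, by simp⟩
        rw [List.mem_iff_getElem]
        exact ⟨k, by simp; omega, by simp⟩
      obtain ⟨c, hc⟩ := Option.isSome_iff_exists.1 this
      simp [hc]
    · rw [h x (by simp [Fm.fv, hx, hxs])]

end closed

theorem session_list {α : Type} [Encodable α] (s : Finset α) :
    ∃ l : List α, encode s = encode l ∧ ∀ x, x ∈ l ↔ x ∈ s := by
  have h1 : ∃ l : List α, encodeMultiset s.val = encode l ∧ ∀ x, x ∈ l ↔ x ∈ s.val := by
    have h2 : ∃ l : List α, encodeMultiset s.val = encode l := by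
      unfold encodeMultiset
      exact ⟨_, rfl⟩
    obtain ⟨l, hl⟩ := h2
    refine ⟨l, hl, fun x => ?_⟩
    have h3 : decode (α := Multiset α) (encode s.val) = some s.val := encodek _
    have h4 : decodeMultiset (α := α) (encodeMultiset s.val) = some s.val := h3
    rw [hl, decodeMultiset, encodek] at h4
    have h5 : (l : Multiset α) = s.val := Option.some.inj h4
    rw [← h5, Multiset.mem_coe]
  exact h1

theorem history_list {C : Type} [Encodable C] (h : History C) :
    ∃ hs : Hs C, encode h = encode hs ∧ hs.length = h.length ∧
      ∀ k e, e ∈ hs.getD k [] ↔ e ∈ h.getD k ∅ := by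
  induction h with
  | nil => exact ⟨[], rfl, rfl, by simp⟩
  | cons s h ih =>
    obtain ⟨hs, h1, h2, h3⟩ := ih
    obtain ⟨l, l1, l2⟩ := session_list s
    refine ⟨l :: hs, ?_, by simp [h2], ?_⟩
    · rw [encode_list_cons, encode_list_cons, h1, l1]
    · intro k e
      cases k with
      | zero => simpa using l2 e
      | succ k => simpa using h3 k e

end MC

/-- Assume constants range over a Primcodable type with computable
equality, each interpreted function is computable, and each interpreted relation is
computable.  Then model checking PTLTL^FO is algorithmically decidable: there is a
computable function which, given (the natural encodings of) a history `h` and a closed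
formula `φ`, returns `true` if `h ⊨ φ` and `false` otherwise. -/
theorem modelchecking_decidable {C : Type} [Primcodable C] [DecidableEq C]
    (F : ℕ → List C → C) (R : ℕ → List C → Bool)
    (hEq : Computable fun q : C × C => decide (q.1 = q.2))
    (hF : Computable fun q : ℕ × List C => F q.1 q.2)
    (hR : Computable fun q : ℕ × List C => R q.1 q.2) :
    ∃ f : ℕ → Bool, Computable f ∧
      ∀ (h : History C) (φ : Fm C), h ≠ [] → φ.Closed →
        (f (Nat.pair (Encodable.encode h) φ.enc) = true ↔
          ∀ ρ : ℕ → C, Sat F R h h.length ρ φ) := by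

  rcases isEmpty_or_nonempty C with hC | ⟨⟨c0⟩⟩
  · exact ⟨fun _ => true, Computable.const true, fun h φ _ _ =>
      ⟨fun _ ρ => (hC.false (ρ 0)).elim, fun _ => rfl⟩⟩
  obtain ⟨T, hTc, hT⟩ := MC.exists_T F c0 hF
  have hb := MC.cBody R c0 hTc hR
  obtain ⟨S, hSc, hS⟩ := MC.cRec (α := MC.Hs C × ℕ)
    (fun a L => (MC.univ c0 a).filter fun u => MC.body R c0 T ((a, L), u))
    (MC.cFilter ((MC.univ_primrec c0).to_comp.comp Computable.fst) hb)
  -- the top level: decode the history, use `code + 1` variables, start with the constant env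
  let D : ℕ → MC.Hs C := fun n => (Encodable.decode (α := MC.Hs C) n.unpair.1).getD []
  have hD : Computable D := MC.cDec _ (MC.cU1 Computable.id)
  have h2 : Computable fun n : ℕ => n.unpair.2 := MC.cU2 Computable.id
  have h2s : Computable fun n : ℕ => n.unpair.2 + 1 := Computable.succ.comp h2
  refine ⟨fun n => decide (((D n).length, MC.updL c0 (n.unpair.2 + 1) [] [] []) ∈
    S (D n, n.unpair.2 + 1) n.unpair.2), ?_, ?_⟩
  · refine MC.cMem (Computable.pair (Computable.list_length.comp hD) ?_)
      (hSc.comp (Computable.pair hD h2s) h2)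
    exact MC.cUpd c0 h2s (Computable.const []) (Computable.const []) (Computable.const [])
  · intro h φ _ hcl
    obtain ⟨hs, e1, e2, e3⟩ := MC.history_list h
    have eD : D (Nat.pair (Encodable.encode h) φ.enc) = hs := by
      simp only [D, Nat.unpair_pair]
      rw [e1, Encodable.encodek]; rfl
    have hu : (hs.length, MC.updL c0 (φ.enc + 1) [] [] []) ∈ MC.univ c0 (hs, φ.enc + 1) := by
      rw [MC.mem_univ]
      exact ⟨le_rfl, by simp [MC.updL], MC.updL_mem (by simp [MC.dom]) (by simp) (by simp)⟩
    have key := MC.correct R c0 T F h hs (φ.enc + 1) e2 e3 hT (S (hs, φ.enc + 1))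
      (fun n => hS _ n) φ (Nat.lt_succ_self _) _ _ hu
    simp only [eD, Nat.unpair_pair, decide_eq_true_iff]
    rw [key, e2]
    constructor
    · intro H ρ
      refine (MC.sat_congr F R h φ _ _ _ ?_).1 H
      intro x hx
      rw [hcl] at hx
      simp at hx
    · intro H
      exact H _
end

section
/- Assume constants range over a Primcodable (computably encoded) type containing the natural numbers, with computable equality, each interpreted function is computable, and each interpreted relation is computable. Then the model checking problem for PTLTL^FO extended with the counting quantifier is algorithmically decidable: there is a computable function which, given a history h and a closed formula φ of the extended language, returns true if h ⊨ φ and false otherwise. -/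
/-- PTLTL^FO formulas extended with the counting quantifier `count x ψ φ`,
i.e. `N x : ψ. φ(x)`. -/
inductive FmN (C : Type) : Type where
  | atom : ℕ → List (Tm C) → FmN C
  | rel : ℕ → List (Tm C) → FmN C
  | and : FmN C → FmN C → FmN C
  | not : FmN C → FmN C
  | prev : FmN C → FmN C
  | since : FmN C → FmN C → FmN C
  | all : List ℕ → ℕ → FmN C → FmN C
  | count : ℕ → FmN C → FmN C → FmN C

/-- Free variables of a formula; in `N x : ψ. φ(x)` the variable `x` binds in `φ`. -/
def FmN.fv {C : Type} : FmN C → List ℕ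
  | .atom _ ts => ts.flatMap Tm.fv
  | .rel _ ts => ts.flatMap Tm.fv
  | .and a b => a.fv ++ b.fv
  | .not a => a.fv
  | .prev a => a.fv
  | .since a b => a.fv ++ b.fv
  | .all xs _ a => a.fv.filter (fun v => v ∉ xs)
  | .count x g a => g.fv ++ a.fv.filter (fun v => v ≠ x)

/-- A formula is closed if it has no free variables. -/
def FmN.Closed {C : Type} (φ : FmN C) : Prop := φ.fv = []

/-- Well-formedness: in `N x : ψ. φ(x)` the variable `x` must not be free in `ψ`. -/
def FmN.WF {C : Type} : FmN C → Prop
  | .atom _ _ => True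
  | .rel _ _ => True
  | .and a b => a.WF ∧ b.WF
  | .not a => a.WF
  | .prev a => a.WF
  | .since a b => a.WF ∧ b.WF
  | .all _ _ a => a.WF
  | .count x g a => x ∉ g.fv ∧ g.WF ∧ a.WF

/-- The forcing relation for the extended language; `ι : ℕ → C` is the inclusion of the
natural numbers into the type of constants (used for the value of the counting
quantifier). -/
def SatN {C : Type} (F : ℕ → List C → C) (R : ℕ → List C → Bool) (ι : ℕ → C)
    (h : History C) : ℕ → (ℕ → C) → FmN C → Prop
  | i, ρ, .atom p ts => (p, ts.map (Tm.eval F ρ)) ∈ h.getD (i - 1) ∅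
  | i, ρ, .rel r ts => R r (ts.map (Tm.eval F ρ)) = true
  | i, ρ, .and a b => SatN F R ι h i ρ a ∧ SatN F R ι h i ρ b
  | i, ρ, .not a => ¬ SatN F R ι h i ρ a
  | i, ρ, .prev a => 1 < i ∧ SatN F R ι h (i - 1) ρ a
  | i, ρ, .since a b =>
      ∃ j, 1 ≤ j ∧ j ≤ i ∧ SatN F R ι h j ρ b ∧ ∀ k, j < k → k ≤ i → SatN F R ι h k ρ a
  | i, ρ, .all xs p a =>
      ∀ cs : List C, cs.length = xs.length → (p, cs) ∈ h.getD (i - 1) ∅ →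
        SatN F R ι h i (updEnv ρ xs cs) a
  | i, ρ, .count x g a =>
      SatN F R ι h i
        (fun v => if v = x then ι (Nat.card {j : ℕ // 1 ≤ j ∧ j ≤ i ∧ SatN F R ι h j ρ g})
         else ρ v) a

/-- A natural-number encoding of formulas of the extended language. -/
def FmN.enc {C : Type} [Encodable C] : FmN C → ℕ
  | .atom p ts => Nat.pair 0 (Nat.pair p (Encodable.encode (ts.map Tm.enc)))
  | .rel r ts => Nat.pair 1 (Nat.pair r (Encodable.encode (ts.map Tm.enc)))
  | .and a b => Nat.pair 2 (Nat.pair a.enc b.enc)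
  | .not a => Nat.pair 3 a.enc
  | .prev a => Nat.pair 4 a.enc
  | .since a b => Nat.pair 5 (Nat.pair a.enc b.enc)
  | .all xs p a => Nat.pair 6 (Nat.pair (Encodable.encode xs) (Nat.pair p a.enc))
  | .count x g a => Nat.pair 7 (Nat.pair x (Nat.pair g.enc a.enc))

section helpers

open Encodable Nat.Partrec

theorem pmap_exists {α β σ : Type} [Primcodable α] [Primcodable β] [Primcodable σ]
    {f : α → β →. σ} (hf : Partrec₂ f) :
    ∃ P : α → List β →. List σ, Partrec₂ P ∧
      ∀ a l (g : β → σ), (∀ b ∈ l, f a b = Part.some (g b)) → P a l = Part.some (l.map g) := by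
  refine ⟨fun a l => Nat.rec (motive := fun _ => Part (List σ)) (Part.some [])
    (fun y IH => IH.bind fun acc => (l[y]? : Part β).bind fun b => (f a b).map fun r => acc ++ [r])
    l.length, ?_, ?_⟩
  · have h1 : Partrec₂ fun (p : α × List β) (q : ℕ × List σ) =>
        ((p.2[q.1]? : Option β) : Part β).bind fun b => (f p.1 b).map fun r => q.2 ++ [r] := by
      refine Partrec.bind (Computable.ofOption
        (Computable.list_getElem?.comp (Computable.snd.comp Computable.fst)
          (Computable.fst.comp Computable.snd))) ?_
      refine Partrec.map (hf.comp (Computable.fst.comp (Computable.fst.comp Computable.fst))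
        Computable.snd) ?_
      exact Computable.list_concat.comp
        (Computable.snd.comp (Computable.snd.comp (Computable.fst.comp Computable.fst)))
        Computable.snd
    exact Partrec.nat_rec (f := fun p : α × List β => p.2.length)
      (Computable.list_length.comp Computable.snd) (Computable.const []).partrec h1
  · intro a l g hg
    have key : ∀ n, n ≤ l.length → Nat.rec (motive := fun _ => Part (List σ)) (Part.some [])
        (fun y IH => IH.bind fun acc => (l[y]? : Part β).bind fun b =>
          (f a b).map fun r => acc ++ [r]) n = Part.some ((l.take n).map g) := by
      intro n
      induction n with
      | zero => intro _; simp
      | succ n ih =>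
        intro hn
        have hlt : n < l.length := hn
        simp only [ih hlt.le, Part.bind_some]
        rw [List.getElem?_eq_getElem hlt]
        rw [List.take_add_one, List.getElem?_eq_getElem hlt]
        simp only [Part.coe_some, Part.bind_some]
        rw [hg _ (List.getElem_mem hlt)]
        simp only [Part.map_some, List.map_append, Option.toList_some, List.map_cons, List.map_nil]
    simpa using key l.length le_rfl

theorem computable_list_map {α β σ : Type} [Primcodable α] [Primcodable β] [Primcodable σ]
    {f : α → List β} {g : α → β → σ} (hf : Computable f) (hg : Computable₂ g) :
    Computable fun a => (f a).map (g a) := by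
  obtain ⟨P, hP, hP'⟩ := pmap_exists (f := fun a b => Part.some (g a b)) hg.partrec₂
  exact (hP.comp Computable.id hf).of_eq fun a => hP' a (f a) (g a) fun _ _ => rfl

/-- Fuelled recursion with a list of recursive calls. -/
def evr {β σ : Type} (calls : β → List β) (comb : β → List σ → σ) (d : σ) : ℕ → β → σ
  | 0, _ => d
  | n + 1, s => comb s ((calls s).map (evr calls comb d n))

theorem evr_computable {β σ : Type} [Primcodable β] [Primcodable σ]
    {calls : β → List β} {comb : β → List σ → σ} (d : σ)
    (hcalls : Computable calls) (hcomb : Computable₂ comb) :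
    Computable₂ (evr calls comb d) := by
  have hf' : Partrec₂ fun (p : Code × ℕ) (b : β) =>
      (Code.eval p.1 (encode (p.2, b))).bind fun r => ((decode r : Option σ) : Part σ) := by
    refine Partrec.bind (Code.eval_part.comp (Computable.fst.comp Computable.fst)
      (Computable.encode.comp ((Computable.snd.comp Computable.fst).pair Computable.snd))) ?_
    exact Computable.ofOption (Computable.decode.comp Computable.snd)
  obtain ⟨P, hP, hP'⟩ := pmap_exists hf'
  have hbody : Partrec₂ fun (c : Code) (q : ℕ × β) =>
      (Nat.casesOn (motive := fun _ => Part σ) q.1 (Part.some d) fun n =>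
        (P (c, n) (calls q.2)).map fun rs => comb q.2 rs) := by
    refine Partrec.nat_casesOn_right (f := fun x : Code × (ℕ × β) => x.2.1)
      (Computable.fst.comp Computable.snd) (Computable.const d) ?_
    refine Partrec.map (hP.comp ((Computable.fst.comp Computable.fst).pair Computable.snd)
      (hcalls.comp (Computable.snd.comp (Computable.snd.comp Computable.fst)))) ?_
    exact hcomb.comp (Computable.snd.comp (Computable.snd.comp (Computable.fst.comp Computable.fst)))
      Computable.snd
  have hF : Partrec₂ fun (c : Code) (m : ℕ) =>
      ((decode m : Option (ℕ × β)) : Part (ℕ × β)).bind fun q =>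
        (Nat.casesOn (motive := fun _ => Part σ) q.1 (Part.some d) fun n =>
        (P (c, n) (calls q.2)).map fun rs => comb q.2 rs).map encode := by
    refine Partrec.bind (Computable.ofOption (Computable.decode.comp Computable.snd)) ?_
    refine Partrec.map (hbody.comp (Computable.fst.comp Computable.fst) Computable.snd) ?_
    exact Computable.encode.comp Computable.snd
  obtain ⟨c, hc⟩ := Code.fixed_point₂ hF
  have key : ∀ n s, Code.eval c (encode (n, s)) = Part.some (encode (evr calls comb d n s)) := by
    intro n
    induction n with
    | zero => intro s; rw [hc]; simp only [encodek]; simp [evr]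
    | succ n ih =>
      intro s
      rw [hc]; simp only [encodek]
      simp only [Part.coe_some, Part.bind_some]
      rw [hP' (c, n) (calls s) (evr calls comb d n)]
      · simp [evr]
      · intro b _
        simp only [ih, Part.bind_some, encodek, Part.coe_some]
  have : Partrec fun p : ℕ × β =>
      (Code.eval c (encode p)).bind fun r => ((decode r : Option σ) : Part σ) := by
    refine Partrec.bind (Code.eval_part.comp (Computable.const c) Computable.encode) ?_
    exact Computable.ofOption (Computable.decode.comp Computable.snd)
  exact this.of_eq fun p => by
    have := key p.1 p.2
    simp [this]

/-- decode a list of codes -/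
def dl (n : ℕ) : List ℕ := (decode n : Option (List ℕ)).getD []

theorem dl_encode (l : List ℕ) : dl (encode l) = l := by simp [dl]

theorem dl_primrec : Primrec dl :=
  Primrec.option_getD.comp Primrec.decode (Primrec.const [])

/-- The environment given by an association list. -/
def envOf {C : Type} (d : C) (e : List (ℕ × C)) : ℕ → C := fun v => (e.lookup v).getD d

def tcalls {C : Type} (s : List (ℕ × C) × ℕ) : List (List (ℕ × C) × ℕ) :=
  bif s.2.unpair.1 == 2 then (dl s.2.unpair.2.unpair.2).map fun t => (s.1, t) else []

def tcomb {C : Type} [Primcodable C] (F : ℕ → List C → C) (d : C) (s : List (ℕ × C) × ℕ)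
    (rs : List C) : C :=
  bif s.2.unpair.1 == 0 then envOf d s.1 s.2.unpair.2
  else bif s.2.unpair.1 == 1 then (decode s.2.unpair.2 : Option C).getD d
  else F s.2.unpair.2.unpair.1 rs

theorem un1 : Primrec fun n : ℕ => n.unpair.1 := Primrec.fst.comp Primrec.unpair
theorem un2 : Primrec fun n : ℕ => n.unpair.2 := Primrec.snd.comp Primrec.unpair

theorem tcalls_primrec {C : Type} [Primcodable C] : Primrec (tcalls (C := C)) := by
  unfold tcalls
  refine Primrec.cond ?_ ?_ (Primrec.const [])
  · exact Primrec.beq.comp (un1.comp Primrec.snd) (Primrec.const 2)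
  · refine Primrec.list_map (dl_primrec.comp (un2.comp (un2.comp Primrec.snd))) ?_
    exact Primrec.pair (Primrec.fst.comp Primrec.fst) Primrec.snd

theorem tcomb_computable {C : Type} [Primcodable C] (F : ℕ → List C → C) (d : C)
    (hF : Computable fun q : ℕ × List C => F q.1 q.2) : Computable₂ (tcomb F d) := by
  have hn : Primrec fun p : (List (ℕ × C) × ℕ) × List C => p.1.2 := Primrec.snd.comp Primrec.fst
  have hF' : Computable₂ F := hF
  have h2 : Computable fun p : (List (ℕ × C) × ℕ) × List C => F p.1.2.unpair.2.unpair.1 p.2 :=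
    hF'.comp (un1.comp (un2.comp hn)).to_comp Computable.snd
  have h3 : Computable fun p : (List (ℕ × C) × ℕ) × List C => envOf d p.1.1 p.1.2.unpair.2 :=
    (Primrec.option_getD.comp (Primrec.listLookup.comp (un2.comp hn)
      (Primrec.fst.comp Primrec.fst)) (Primrec.const d)).to_comp
  have h4 : Computable fun p : (List (ℕ × C) × ℕ) × List C =>
      (decode p.1.2.unpair.2 : Option C).getD d :=
    (Primrec.option_getD.comp (Primrec.decode.comp (un2.comp hn)) (Primrec.const d)).to_comp
  exact Computable.cond (Primrec.beq.comp (un1.comp hn) (Primrec.const 0)).to_comp h3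
    (Computable.cond (Primrec.beq.comp (un1.comp hn) (Primrec.const 1)).to_comp h4 h2)

def tev {C : Type} [Primcodable C] (F : ℕ → List C → C) (d : C) (e : List (ℕ × C)) (t : ℕ) : C :=
  evr tcalls (tcomb F d) d (t + 1) (e, t)

theorem tev_computable {C : Type} [Primcodable C] (F : ℕ → List C → C) (d : C)
    (hF : Computable fun q : ℕ × List C => F q.1 q.2) : Computable₂ (tev F d) :=
  (evr_computable d tcalls_primrec.to_comp (tcomb_computable F d hF)).comp
    (Computable.succ.comp Computable.snd) Computable.id

theorem mem_lt_encode {l : List ℕ} {x : ℕ} (h : x ∈ l) : x < encode l := by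
  induction l with
  | nil => simp at h
  | cons a l ih =>
    rw [Encodable.encode_list_cons]
    rcases List.mem_cons.1 h with rfl | h
    · exact Nat.lt_succ_of_le (Nat.left_le_pair _ _)
    · exact (ih h).trans_le ((Nat.right_le_pair _ _).trans (Nat.le_succ _))

theorem tev_aux {C : Type} [Primcodable C] (F : ℕ → List C → C) (d : C) (e : List (ℕ × C)) :
    ∀ (n : ℕ) (t : Tm C), t.enc < n →
      evr tcalls (tcomb F d) d n (e, t.enc) = t.eval F (envOf d e) := by
  intro n
  induction n with
  | zero => intro t h; omega
  | succ n ih =>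
    intro t ht
    cases t with
    | var x => simp [evr, Tm.enc, tcomb, Tm.eval]
    | const c => simp [evr, Tm.enc, tcomb, Tm.eval]
    | func f args =>
      have h0 : ∀ a ∈ args, a.enc < n := by
        intro a ha
        have h1 : a.enc < encode (args.attach.map fun t => Tm.enc t.1) := by
          apply mem_lt_encode
          simpa using ⟨a, ha, rfl⟩
        rw [Tm.enc] at ht
        have h2 := Nat.right_le_pair f (encode (args.attach.map fun t => Tm.enc t.1))
        have h3 := Nat.right_le_pair 2 (Nat.pair f (encode (args.attach.map fun t => Tm.enc t.1)))
        omega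
      rw [evr, Tm.enc, Tm.eval]
      simp only [tcomb, tcalls, Nat.unpair_pair, dl_encode]
      simp only [List.map_map]
      simp
      congr 1
      apply List.map_congr_left
      intro a ha
      simpa using ih a (h0 a ha)

theorem tev_eq {C : Type} [Primcodable C] (F : ℕ → List C → C) (d : C) (e : List (ℕ × C))
    (t : Tm C) : tev F d e t.enc = t.eval F (envOf d e) :=
  tev_aux F d e _ t (Nat.lt_succ_self _)

/-- States of the formula evaluator: history, environment, position, formula code. -/
abbrev St (C : Type) := (List (List (ℕ × List C)) × List (ℕ × C)) × ℕ × ℕ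

def zipR {C : Type} (xs : List ℕ) (cs : List C) : List (ℕ × C) :=
  (List.range xs.length).filterMap fun k =>
    xs[k]?.bind fun x => cs[k]?.map fun c => (x, c)

theorem zipR_eq {C : Type} (xs : List ℕ) (cs : List C) : zipR xs cs = xs.zip cs := by
  induction xs generalizing cs with
  | nil => simp [zipR]
  | cons x xs ih =>
    cases cs with
    | nil => simp [zipR]
    | cons c cs =>
      rw [List.zip_cons_cons, ← ih]
      simp [zipR, List.range_succ_eq_map, List.filterMap_map]

theorem zipR_primrec {C : Type} [Primcodable C] : Primrec₂ (zipR (C := C)) := by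
  unfold zipR
  refine Primrec.listFilterMap
    (Primrec.list_range.comp (Primrec.list_length.comp Primrec.fst)) ?_
  refine Primrec.option_bind (Primrec.list_getElem?.comp (Primrec.fst.comp Primrec.fst)
    Primrec.snd) ?_
  refine Primrec.option_map (Primrec.list_getElem?.comp
    (Primrec.snd.comp (Primrec.fst.comp Primrec.fst)) (Primrec.snd.comp Primrec.fst)) ?_
  exact Primrec.pair (Primrec.snd.comp Primrec.fst) Primrec.snd

section calls
variable {C : Type}

def ca2 (s : St C) : List (St C) :=
  [(s.1, s.2.1, s.2.2.unpair.2.unpair.1), (s.1, s.2.1, s.2.2.unpair.2.unpair.2)]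
def ca3 (s : St C) : List (St C) := [(s.1, s.2.1, s.2.2.unpair.2)]
def ca4 (s : St C) : List (St C) := [(s.1, s.2.1 - 1, s.2.2.unpair.2)]
/-- evaluate the formula `m` at all positions up to the current one -/
def caAll (s : St C) (m : ℕ) : List (St C) :=
  (List.range s.2.1).map fun j => (s.1, j + 1, m)
def ca5 (s : St C) : List (St C) :=
  caAll s s.2.2.unpair.2.unpair.1 ++ caAll s s.2.2.unpair.2.unpair.2
def ca6 (s : St C) : List (St C) :=
  (s.1.1.getD (s.2.1 - 1) []).filterMap fun q =>
    if q.1 = s.2.2.unpair.2.unpair.2.unpair.1 ∧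
        q.2.length = (dl s.2.2.unpair.2.unpair.1).length then
      some ((s.1.1, zipR (dl s.2.2.unpair.2.unpair.1) q.2 ++ s.1.2), s.2.1,
        s.2.2.unpair.2.unpair.2.unpair.2)
    else none
def ca7 (ι : ℕ → C) (s : St C) : List (St C) :=
  caAll s s.2.2.unpair.2.unpair.2.unpair.1 ++
  (List.range (s.2.1 + 1)).map fun m =>
    ((s.1.1, (s.2.2.unpair.2.unpair.1, ι m) :: s.1.2), s.2.1, s.2.2.unpair.2.unpair.2.unpair.2)

def fcalls (ι : ℕ → C) (s : St C) : List (St C) :=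
  bif s.2.2.unpair.1 == 2 then ca2 s
  else bif s.2.2.unpair.1 == 3 then ca3 s
  else bif s.2.2.unpair.1 == 4 then ca4 s
  else bif s.2.2.unpair.1 == 5 then ca5 s
  else bif s.2.2.unpair.1 == 6 then ca6 s
  else bif s.2.2.unpair.1 == 7 then ca7 ι s
  else []

variable [Primcodable C]

theorem st_n : Primrec fun s : St C => s.2.2 := Primrec.snd.comp Primrec.snd
theorem st_i : Primrec fun s : St C => s.2.1 := Primrec.fst.comp Primrec.snd
theorem st_e : Primrec fun s : St C => s.1.2 := Primrec.snd.comp Primrec.fst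
theorem st_h : Primrec fun s : St C => s.1.1 := Primrec.fst.comp Primrec.fst
theorem st_c : Primrec fun s : St C => s.1 := Primrec.fst

theorem list1 {α β : Type} [Primcodable α] [Primcodable β] {f : α → β} (hf : Primrec f) :
    Primrec fun a => [f a] := Primrec.list_cons.comp hf (Primrec.const [])

theorem ca2_primrec : Primrec (ca2 (C := C)) :=
  Primrec.list_cons.comp (st_c.pair (st_i.pair (un1.comp (un2.comp st_n))))
    (list1 (st_c.pair (st_i.pair (un2.comp (un2.comp st_n)))))

theorem ca3_primrec : Primrec (ca3 (C := C)) :=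
  list1 (st_c.pair (st_i.pair (un2.comp st_n)))

theorem ca4_primrec : Primrec (ca4 (C := C)) :=
  list1 (st_c.pair ((Primrec.pred.comp st_i).pair (un2.comp st_n)))

theorem caAll_primrec : Primrec₂ (caAll (C := C)) := by
  refine Primrec.list_map (Primrec.list_range.comp (st_i.comp Primrec.fst)) ?_
  exact (st_c.comp (Primrec.fst.comp Primrec.fst)).pair
    ((Primrec.succ.comp Primrec.snd).pair (Primrec.snd.comp Primrec.fst))

theorem ca5_primrec : Primrec (ca5 (C := C)) :=
  Primrec.list_append.comp
    (caAll_primrec.comp Primrec.id (un1.comp (un2.comp st_n)))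
    (caAll_primrec.comp Primrec.id (un2.comp (un2.comp st_n)))

/-- the current session -/
def sess (s : St C) : List (ℕ × List C) := s.1.1.getD (s.2.1 - 1) []

theorem sess_primrec : Primrec (sess (C := C)) :=
  (Primrec.list_getD []).comp st_h (Primrec.pred.comp st_i)

theorem ca6_primrec : Primrec (ca6 (C := C)) := by
  refine Primrec.listFilterMap sess_primrec ?_
  have hn : Primrec fun p : St C × (ℕ × List C) => p.1.2.2 := st_n.comp Primrec.fst
  have hx : Primrec fun p : St C × (ℕ × List C) => dl p.1.2.2.unpair.2.unpair.1 :=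
    dl_primrec.comp (un1.comp (un2.comp hn))
  refine Primrec.ite (PrimrecPred.and ?_ ?_) (Primrec.option_some.comp ?_) (Primrec.const none)
  · exact Primrec.eq.comp (Primrec.fst.comp Primrec.snd) (un1.comp (un2.comp (un2.comp hn)))
  · exact Primrec.eq.comp (Primrec.list_length.comp (Primrec.snd.comp Primrec.snd))
      (Primrec.list_length.comp hx)
  · exact ((st_h.comp Primrec.fst).pair (Primrec.list_append.comp
      (zipR_primrec.comp hx (Primrec.snd.comp Primrec.snd)) (st_e.comp Primrec.fst))).pair
      ((st_i.comp Primrec.fst).pair (un2.comp (un2.comp (un2.comp hn))))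

theorem ca7_computable {ι : ℕ → C} (hι : Computable ι) : Computable (ca7 ι) := by
  refine Computable.list_append.comp
    (caAll_primrec.comp Primrec.id (un1.comp (un2.comp (un2.comp st_n)))).to_comp
    (computable_list_map
      (Primrec.list_range.comp (Primrec.succ.comp st_i)).to_comp ?_)
  have hn : Primrec fun p : St C × ℕ => p.1.2.2 := st_n.comp Primrec.fst
  exact Computable.pair ((st_h.comp Primrec.fst).to_comp.pair
    (Computable.list_cons.comp
      ((un1.comp (un2.comp hn)).to_comp.pair (hι.comp Computable.snd))
      (st_e.comp Primrec.fst).to_comp))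
    ((st_i.comp Primrec.fst).pair (un2.comp (un2.comp (un2.comp hn)))).to_comp

theorem fcalls_computable {ι : ℕ → C} (hι : Computable ι) : Computable (fcalls ι) := by
  have ht : ∀ k : ℕ, Computable fun s : St C => s.2.2.unpair.1 == k := fun k =>
    (Primrec.beq.comp (un1.comp st_n) (Primrec.const k)).to_comp
  exact Computable.cond (ht 2) ca2_primrec.to_comp
    (Computable.cond (ht 3) ca3_primrec.to_comp
    (Computable.cond (ht 4) ca4_primrec.to_comp
    (Computable.cond (ht 5) ca5_primrec.to_comp
    (Computable.cond (ht 6) ca6_primrec.to_comp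
    (Computable.cond (ht 7) (ca7_computable hι) (Computable.const []))))))

end calls

section comb
variable {C : Type}

/-- `since` combination; `rs` holds the values of `a` and then of `b` at positions `1..i`. -/
def SinceP (i : ℕ) (rs : List Bool) : Prop :=
  ∃ j ∈ List.range i, rs.getD (i + j) false = true ∧ ∀ k ∈ List.range i, ¬ j < k ∨ rs.getD k false = true

instance (i : ℕ) (rs : List Bool) : Decidable (SinceP i rs) := by unfold SinceP; infer_instance

theorem sinceP_primrec : PrimrecPred fun p : ℕ × List Bool => SinceP p.1 p.2 := by
  have h1 : PrimrecRel fun (k : ℕ) (y : ℕ × (ℕ × List Bool)) =>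
      ¬ y.1 < k ∨ y.2.2.getD k false = true := by
    refine PrimrecPred.or (PrimrecPred.not (Primrec.nat_lt.comp
      (Primrec.fst.comp Primrec.snd) Primrec.fst)) ?_
    exact Primrec.eq.comp ((Primrec.list_getD false).comp
      (Primrec.snd.comp (Primrec.snd.comp Primrec.snd)) Primrec.fst) (Primrec.const true)
  have h1' : PrimrecRel fun (n : List ℕ) (y : ℕ × (ℕ × List Bool)) =>
      ∀ k ∈ n, ¬ y.1 < k ∨ y.2.2.getD k false = true :=
    PrimrecRel.forall_mem_list h1
  have h2 : PrimrecRel fun (j : ℕ) (y : ℕ × List Bool) =>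
      y.2.getD (y.1 + j) false = true ∧ ∀ k ∈ List.range y.1, ¬ j < k ∨ y.2.getD k false = true := by
    refine PrimrecPred.and ?_ ?_
    · exact Primrec.eq.comp ((Primrec.list_getD false).comp
        (Primrec.snd.comp Primrec.snd)
        (Primrec.nat_add.comp (Primrec.fst.comp Primrec.snd) Primrec.fst)) (Primrec.const true)
    · exact h1'.comp (f := fun p : ℕ × (ℕ × List Bool) => List.range p.2.1) (g := fun p => p)
        (Primrec.list_range.comp (Primrec.fst.comp Primrec.snd)) Primrec.id
  have h2' : PrimrecRel fun (n : List ℕ) (y : ℕ × List Bool) => ∃ j ∈ n,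
      y.2.getD (y.1 + j) false = true ∧ ∀ k ∈ List.range y.1, ¬ j < k ∨ y.2.getD k false = true :=
    PrimrecRel.exists_mem_list h2
  exact h2'.comp (f := fun p : ℕ × List Bool => List.range p.1) (g := fun p => p)
    (Primrec.list_range.comp Primrec.fst) Primrec.id

variable [Primcodable C] [DecidableEq C]

/-- values of the arguments of an atom -/
def argv (F : ℕ → List C → C) (d : C) (s : St C) : ℕ × List C :=
  (s.2.2.unpair.2.unpair.1, (dl s.2.2.unpair.2.unpair.2).map fun t => tev F d s.1.2 t)

def fcomb (F : ℕ → List C → C) (R : ℕ → List C → Bool) (d : C) (s : St C) (rs : List Bool) :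
    Bool :=
  bif s.2.2.unpair.1 == 0 then decide (∃ q ∈ sess s, q = argv F d s)
  else bif s.2.2.unpair.1 == 1 then R (argv F d s).1 (argv F d s).2
  else bif s.2.2.unpair.1 == 3 then !(rs.getD 0 false)
  else bif s.2.2.unpair.1 == 4 then decide (1 < s.2.1) && rs.getD 0 false
  else bif s.2.2.unpair.1 == 5 then decide (SinceP s.2.1 rs)
  else bif s.2.2.unpair.1 == 7 then
    rs.getD (s.2.1 + ((rs.take s.2.1).filter fun b => b = true).length) false
  else decide (∀ r ∈ rs, r = true)

theorem argv_computable (F : ℕ → List C → C) (d : C)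
    (hF : Computable fun q : ℕ × List C => F q.1 q.2) : Computable (argv F d) := by
  refine Computable.pair (un1.comp (un2.comp st_n)).to_comp
    (computable_list_map (dl_primrec.comp (un2.comp (un2.comp st_n))).to_comp ?_)
  exact (tev_computable F d hF).comp (st_e.comp Primrec.fst).to_comp Computable.snd

theorem fcomb_computable (F : ℕ → List C → C) (R : ℕ → List C → Bool) (d : C)
    (hF : Computable fun q : ℕ × List C => F q.1 q.2)
    (hR : Computable fun q : ℕ × List C => R q.1 q.2) : Computable₂ (fcomb F R d) := by
  have ht : ∀ k : ℕ, Computable fun p : St C × List Bool => p.1.2.2.unpair.1 == k := fun k =>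
    (Primrec.beq.comp (un1.comp (st_n.comp Primrec.fst)) (Primrec.const k)).to_comp
  have ha : Computable fun p : St C × List Bool => argv F d p.1 :=
    (argv_computable F d hF).comp Computable.fst
  have hi : Primrec fun p : St C × List Bool => p.1.2.1 := st_i.comp Primrec.fst
  have h0 : Primrec fun p : St C × List Bool => p.2.getD 0 false :=
    (Primrec.list_getD false).comp Primrec.snd (Primrec.const 0)
  refine Computable.cond (ht 0) ?_ (Computable.cond (ht 1) ?_ (Computable.cond (ht 3) ?_
    (Computable.cond (ht 4) ?_ (Computable.cond (ht 5) ?_ (Computable.cond (ht 7) ?_ ?_)))))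
  · have h1 : Primrec₂ fun (l : List (ℕ × List C)) (b : ℕ × List C) =>
        decide (∃ q ∈ l, q = b) :=
      (PrimrecRel.exists_mem_list (R := fun q b : ℕ × List C => q = b) Primrec.eq).decide
    exact h1.to_comp.comp (sess_primrec.comp Primrec.fst).to_comp ha
  · exact Computable.comp (f := fun q : ℕ × List C => R q.1 q.2) hR ha
  · exact (Primrec.not.comp h0).to_comp
  · exact (Primrec.and.comp (Primrec.nat_lt.comp (Primrec.const 1) hi).decide h0).to_comp
  · exact (PrimrecPred.comp sinceP_primrec (hi.pair Primrec.snd)).decide.to_comp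
  · refine ((Primrec.list_getD false).comp Primrec.snd (Primrec.nat_add.comp hi
      (Primrec.list_length.comp ?_))).to_comp
    refine Primrec.comp (Primrec.listFilter (p := fun b : Bool => b = true) ?_)
      (Primrec.list_take.comp hi Primrec.snd)
    exact Primrec.eq.comp Primrec.id (Primrec.const true)
  · have h1 : PrimrecPred fun (l : List Bool) => ∀ r ∈ l, r = true :=
      PrimrecPred.forall_mem_list (p := fun r : Bool => r = true)
        (Primrec.eq.comp Primrec.id (Primrec.const true))
    exact (h1.comp Primrec.snd).decide.to_comp

end comb

section correctness

theorem encode_finset_decode {α : Type} [Encodable α] (s : Finset α) :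
    ∃ l : List α, (decode (encode s) : Option (List α)) = some l ∧ ∀ x, x ∈ l ↔ x ∈ s := by
  have h0 : encode s = encode s.1 := rfl
  have h1 : (decode (encode s.1) : Option (Multiset α)) = some s.1 := encodek _
  have h2 : (decode (encode s.1) : Option (Multiset α)) =
    ((↑) : List α → Multiset α) <$> (decode (encode s.1) : Option (List α)) := rfl
  rw [h2] at h1
  rw [h0]
  cases hd : (decode (encode s.1) : Option (List α)) with
  | none => rw [hd] at h1; simp at h1
  | some l =>
    rw [hd] at h1
    refine ⟨l, rfl, fun x => ?_⟩
    have h3 : (l : Multiset α) = s.1 := by simpa using h1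
    rw [← Finset.mem_val, ← h3]; simp

theorem encode_list_map {α : Type} [Encodable α] (l : List α) :
    encode l = encode (l.map encode) := by
  induction l with
  | nil => rfl
  | cons a l ih => simp [ih]

/-- decode a history -/
def dh {C : Type} [Primcodable C] (n : ℕ) : List (List (ℕ × List C)) :=
  (dl n).map fun k => (decode k : Option (List (ℕ × List C))).getD []

theorem dh_primrec {C : Type} [Primcodable C] : Primrec (dh (C := C)) :=
  Primrec.list_map dl_primrec
    (Primrec.option_getD.comp (Primrec.decode.comp Primrec.snd) (Primrec.const []))

theorem dh_length {C : Type} [Primcodable C] (h : History C) :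
    (dh (C := C) (encode h)).length = h.length := by
  rw [encode_list_map, dh, dl_encode]; simp

theorem dh_mem {C : Type} [Primcodable C] (h : History C) (k : ℕ) (x : ℕ × List C) :
    x ∈ (dh (encode h)).getD k [] ↔ x ∈ h.getD k ∅ := by
  rw [encode_list_map, dh, dl_encode]
  simp only [List.getD_eq_getElem?_getD, List.getElem?_map]
  cases hk : h[k]? with
  | none => simp
  | some s =>
    obtain ⟨l, hl, hl'⟩ := encode_finset_decode s
    simp [hl, hl']

theorem Tm.eval_congr {C : Type} (F : ℕ → List C → C) (ρ ρ' : ℕ → C) :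
    ∀ (t : Tm C), (∀ v ∈ t.fv, ρ v = ρ' v) → t.eval F ρ = t.eval F ρ'
  | .var x, h => by simpa [Tm.eval, Tm.fv] using h
  | .const c, _ => by simp [Tm.eval]
  | .func f args, h => by
    rw [Tm.eval, Tm.eval]
    congr 1
    apply List.map_congr_left
    intro a _
    apply Tm.eval_congr F ρ ρ' a.1
    intro v hv
    apply h
    rw [Tm.fv]
    simp only [List.mem_flatMap]
    exact ⟨a, List.mem_attach _ _, hv⟩
  termination_by t => sizeOf t
  decreasing_by simp_wf; have := List.sizeOf_lt_of_mem a.2; omega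

theorem map_eval_congr {C : Type} (F : ℕ → List C → C) (ρ ρ' : ℕ → C) (ts : List (Tm C))
    (h : ∀ v ∈ ts.flatMap Tm.fv, ρ v = ρ' v) : ts.map (Tm.eval F ρ) = ts.map (Tm.eval F ρ') :=
  List.map_congr_left fun t ht => Tm.eval_congr F ρ ρ' t fun v hv =>
    h v (List.mem_flatMap.2 ⟨t, ht, hv⟩)

theorem lookup_zip_isSome {C : Type} (v : ℕ) (xs : List ℕ) (cs : List C)
    (hl : cs.length = xs.length) (hv : v ∈ xs) : ∃ c, (xs.zip cs).lookup v = some c := by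
  induction xs generalizing cs with
  | nil => simp at hv
  | cons x xs ih =>
    cases cs with
    | nil => simp at hl
    | cons c cs =>
      rw [List.zip_cons_cons, List.lookup_cons]
      by_cases hx : v = x
      · simp [hx]
      · have : (v == x) = false := by simpa using hx
        rw [this]
        exact ih cs (by simpa using hl) (by simpa [hx] using hv)

theorem SatN_congr {C : Type} (F : ℕ → List C → C) (R : ℕ → List C → Bool) (ι : ℕ → C)
    (h : History C) (φ : FmN C) : ∀ (i : ℕ) (ρ ρ' : ℕ → C), (∀ v ∈ φ.fv, ρ v = ρ' v) →
      (SatN F R ι h i ρ φ ↔ SatN F R ι h i ρ' φ) := by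
  induction φ with
  | atom p ts => intro i ρ ρ' hρ; simp only [SatN]; rw [map_eval_congr F ρ ρ' ts hρ]
  | rel p ts => intro i ρ ρ' hρ; simp only [SatN]; rw [map_eval_congr F ρ ρ' ts hρ]
  | and a b iha ihb =>
    intro i ρ ρ' hρ
    simp only [FmN.fv, List.mem_append] at hρ
    simp only [SatN]
    rw [iha i ρ ρ' fun v hv => hρ v (.inl hv), ihb i ρ ρ' fun v hv => hρ v (.inr hv)]
  | not a ih => intro i ρ ρ' hρ; simp only [SatN]; rw [ih i ρ ρ' hρ]
  | prev a ih => intro i ρ ρ' hρ; simp only [SatN]; rw [ih (i - 1) ρ ρ' hρ]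
  | since a b iha ihb =>
    intro i ρ ρ' hρ
    simp only [FmN.fv, List.mem_append] at hρ
    simp only [SatN, fun j => iha j ρ ρ' fun v hv => hρ v (.inl hv),
      fun j => ihb j ρ ρ' fun v hv => hρ v (.inr hv)]
  | all xs p a ih =>
    intro i ρ ρ' hρ
    simp only [SatN]
    refine forall_congr' fun cs => forall_congr' fun hcs => forall_congr' fun _ => ih _ _ _ ?_
    intro v hv
    unfold updEnv
    by_cases hx : v ∈ xs
    · obtain ⟨c, hc⟩ := lookup_zip_isSome v xs cs hcs hx
      simp [hc]
    · rw [hρ v (by simp [FmN.fv, hv, hx])]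
  | count x g a ihg iha =>
    intro i ρ ρ' hρ
    simp only [FmN.fv, List.mem_append] at hρ
    simp only [SatN, fun j => ihg j ρ ρ' fun v hv => hρ v (.inl hv)]
    apply iha
    intro v hv
    by_cases hx : v = x
    · simp [hx]
    · simp only [hx, if_false]
      exact hρ v (.inr (by simp [hv, hx]))

theorem envOf_zip {C : Type} (d : C) (e : List (ℕ × C)) (xs : List ℕ) (cs : List C) :
    envOf d (zipR xs cs ++ e) = updEnv (envOf d e) xs cs := by
  funext v
  simp only [envOf, updEnv, zipR_eq, List.lookup_append]
  cases (xs.zip cs).lookup v <;> simp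

theorem envOf_cons {C : Type} (d : C) (e : List (ℕ × C)) (x : ℕ) (c : C) :
    envOf d ((x, c) :: e) = fun v => if v = x then c else envOf d e v := by
  funext v
  simp only [envOf, List.lookup_cons]
  by_cases hx : v = x
  · simp [hx]
  · have : (v == x) = false := by simpa using hx
    simp [this, hx]

theorem card_eq_filter (i : ℕ) (b : ℕ → Bool) (P : ℕ → Prop) (hb : ∀ j, b j = true ↔ P j) :
    Nat.card {j : ℕ // 1 ≤ j ∧ j ≤ i ∧ P j} =
      (((List.range i).map fun j => b (j + 1)).filter fun b => b = true).length := by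
  have h1 : Nat.card {j : ℕ // 1 ≤ j ∧ j ≤ i ∧ P j} =
      (((Finset.range i).filter fun j => b (j + 1) = true).image (· + 1)).card := by
    apply Nat.subtype_card
    intro x
    simp only [Finset.mem_image, Finset.mem_filter, Finset.mem_range, hb]
    constructor
    · rintro ⟨a, ⟨h1, h2⟩, rfl⟩; exact ⟨by omega, by omega, h2⟩
    · rintro ⟨h1, h2, h3⟩
      exact ⟨x - 1, ⟨by omega, by rwa [Nat.sub_add_cancel h1]⟩, by omega⟩
  rw [h1, Finset.card_image_of_injective _ (add_left_injective 1), List.filter_map,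
    List.length_map]
  rfl

variable {C : Type} [Primcodable C] [DecidableEq C]

theorem getD_left (i k m : ℕ) (A B : ℕ → Bool) (hk : k < i) :
    ((List.range i).map A ++ (List.range m).map B).getD k false = A k := by
  simp [List.getD_eq_getElem?_getD, List.getElem?_append, hk]

theorem getD_right (i k m : ℕ) (A B : ℕ → Bool) (hk : k < m) :
    ((List.range i).map A ++ (List.range m).map B).getD (i + k) false = B k := by
  simp [List.getD_eq_getElem?_getD, List.getElem?_append, hk]

theorem sinceP_iff (i : ℕ) (A B : ℕ → Bool) :
    SinceP i ((List.range i).map (fun j => A (j + 1)) ++ (List.range i).map (fun j => B (j + 1))) ↔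
      ∃ j, 1 ≤ j ∧ j ≤ i ∧ B j = true ∧ ∀ k, j < k → k ≤ i → A k = true := by
  unfold SinceP
  constructor
  · rintro ⟨j, hj, hB, hA⟩
    rw [List.mem_range] at hj
    rw [getD_right _ _ _ _ _ hj] at hB
    refine ⟨j + 1, by omega, by omega, hB, fun k h1 h2 => ?_⟩
    have h3 := hA (k - 1) (List.mem_range.2 (by omega))
    rw [getD_left _ _ _ _ _ (by omega), Nat.sub_add_cancel (by omega)] at h3
    rcases h3 with h3 | h3
    · omega
    · exact h3
  · rintro ⟨j, h1, h2, hB, hA⟩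
    refine ⟨j - 1, List.mem_range.2 (by omega), ?_, fun k hk => ?_⟩
    · rw [getD_right _ _ _ _ _ (by omega), Nat.sub_add_cancel h1]; exact hB
    · rw [List.mem_range] at hk
      rw [getD_left _ _ _ _ _ hk]
      by_cases hjk : j - 1 < k
      · exact .inr (hA _ (by omega) (by omega))
      · exact .inl hjk

theorem fev_aux (F : ℕ → List C → C) (R : ℕ → List C → Bool) (ι : ℕ → C) (d : C)
    (h : History C) (H : List (List (ℕ × List C)))
    (hH : ∀ k x, x ∈ H.getD k [] ↔ x ∈ h.getD k ∅) :
    ∀ (n : ℕ) (φ : FmN C) (e : List (ℕ × C)) (i : ℕ), φ.enc < n →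
      (evr (fcalls ι) (fcomb F R d) false n ((H, e), i, φ.enc) = true ↔
        SatN F R ι h i (envOf d e) φ) := by
  intro n
  induction n with
  | zero => intro φ e i hn; omega
  | succ n ih =>
    intro φ e i hn
    cases φ with
    | atom p ts =>
      simp only [evr, FmN.enc, fcomb, argv, sess, Nat.unpair_pair, dl_encode, SatN, List.map_map]
      have : ts.map ((fun t => tev F d e t) ∘ Tm.enc) = ts.map (Tm.eval F (envOf d e)) :=
        List.map_congr_left fun t _ => tev_eq F d e t
      rw [this]
      simp only [BEq.rfl, cond_true, decide_eq_true_eq, exists_eq_right]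
      exact hH _ _
    | rel p ts =>
      simp only [evr, FmN.enc, fcomb, argv, sess, Nat.unpair_pair, dl_encode, SatN, List.map_map]
      have : ts.map ((fun t => tev F d e t) ∘ Tm.enc) = ts.map (Tm.eval F (envOf d e)) :=
        List.map_congr_left fun t _ => tev_eq F d e t
      rw [this]
      simp
    | and a b =>
      have h1 := Nat.right_le_pair a.enc b.enc
      have h2 := Nat.left_le_pair a.enc b.enc
      have h3 := Nat.add_le_pair 2 (Nat.pair a.enc b.enc)
      simp only [FmN.enc] at hn
      have iha := ih a e i (by omega)
      have ihb := ih b e i (by omega)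
      simp [evr, FmN.enc, fcomb, fcalls, ca2, SatN, ← iha, ← ihb]
    | not a =>
      have h3 := Nat.add_le_pair 3 a.enc
      simp only [FmN.enc] at hn
      have iha := ih a e i (by omega)
      simp [evr, FmN.enc, fcomb, fcalls, ca3, SatN, ← iha]
    | prev a =>
      have h3 := Nat.add_le_pair 4 a.enc
      simp only [FmN.enc] at hn
      have iha := ih a e (i - 1) (by omega)
      simp [evr, FmN.enc, fcomb, fcalls, ca4, SatN, ← iha]
    | since a b =>
      have h1 := Nat.right_le_pair a.enc b.enc
      have h2 := Nat.left_le_pair a.enc b.enc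
      have h3 := Nat.add_le_pair 5 (Nat.pair a.enc b.enc)
      simp only [FmN.enc] at hn
      have iha := fun i => ih a e i (by omega)
      have ihb := fun i => ih b e i (by omega)
      have e1 : ∀ rs, fcomb F R d ((H, e), i, Nat.pair 5 (Nat.pair a.enc b.enc)) rs =
          decide (SinceP i rs) := fun rs => by simp [fcomb]
      have e2 : fcalls ι ((H, e), i, Nat.pair 5 (Nat.pair a.enc b.enc)) =
          (List.range i).map (fun j => ((H, e), j + 1, a.enc)) ++
          (List.range i).map (fun j => ((H, e), j + 1, b.enc)) := by simp [fcalls, ca5, caAll]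
      rw [FmN.enc, evr, e1, e2, decide_eq_true_eq, List.map_append, List.map_map, List.map_map]
      simp only [SatN, ← iha, ← ihb]
      exact sinceP_iff i (fun j => evr (fcalls ι) (fcomb F R d) false n ((H, e), j, a.enc))
        (fun j => evr (fcalls ι) (fcomb F R d) false n ((H, e), j, b.enc))
    | all xs p a =>
      have h1 := Nat.right_le_pair p a.enc
      have h2 := Nat.right_le_pair (encode xs) (Nat.pair p a.enc)
      have h3 := Nat.add_le_pair 6 (Nat.pair (encode xs) (Nat.pair p a.enc))
      simp only [FmN.enc] at hn
      have iha := fun e => ih a e i (by omega)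
      simp only [evr, FmN.enc, fcomb, fcalls, ca6, Nat.unpair_pair, SatN, dl_encode,
        ← envOf_zip, ← iha, ← hH]
      simp
      exact forall_congr' fun cs => ⟨fun h a b => h b a, fun h a b => h b a⟩
    | count x g a =>
      have h1 := Nat.right_le_pair g.enc a.enc
      have h1' := Nat.left_le_pair g.enc a.enc
      have h2 := Nat.right_le_pair x (Nat.pair g.enc a.enc)
      have h3 := Nat.add_le_pair 7 (Nat.pair x (Nat.pair g.enc a.enc))
      simp only [FmN.enc] at hn
      have iha := fun e => ih a e i (by omega)
      have ihg := fun i => ih g e i (by omega)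
      have e1 : ∀ rs, fcomb F R d ((H, e), i, Nat.pair 7 (Nat.pair x (Nat.pair g.enc a.enc))) rs =
          rs.getD (i + ((rs.take i).filter fun b => b = true).length) false :=
        fun rs => by simp [fcomb]
      have e2 : fcalls ι ((H, e), i, Nat.pair 7 (Nat.pair x (Nat.pair g.enc a.enc))) =
          (List.range i).map (fun j => ((H, e), j + 1, g.enc)) ++
          (List.range (i + 1)).map (fun m => ((H, (x, ι m) :: e), i, a.enc)) := by
        simp [fcalls, ca7, caAll]
      rw [FmN.enc, evr, e1, e2, List.map_append, List.map_map, List.map_map]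
      simp only [SatN, card_eq_filter i _ _ ihg, ← envOf_cons, ← iha]
      rw [List.take_left' (by simp)]
      simp only [Function.comp_def]
      rw [getD_right]
      refine Nat.lt_succ_of_le ((List.length_filter_le _ _).trans ?_)
      simp

end correctness

end helpers

/-- Assume constants range over a Primcodable type containing the
natural numbers (via a computable injection `ι`), with computable equality, computable
interpreted functions and computable interpreted relations.  Then model checking for
PTLTL^FO extended with the counting quantifier is algorithmically decidable. -/
theorem counting_modelchecking_decidable {C : Type} [Primcodable C] [DecidableEq C]
    (ι : ℕ → C) (hι : Function.Injective ι) (hιc : Computable ι)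
    (F : ℕ → List C → C) (R : ℕ → List C → Bool)
    (hEq : Computable fun q : C × C => decide (q.1 = q.2))
    (hF : Computable fun q : ℕ × List C => F q.1 q.2)
    (hR : Computable fun q : ℕ × List C => R q.1 q.2) :
    ∃ f : ℕ → Bool, Computable f ∧
      ∀ (h : History C) (φ : FmN C), h ≠ [] → φ.Closed → φ.WF →
        (f (Nat.pair (Encodable.encode h) φ.enc) = true ↔
          ∀ ρ : ℕ → C, SatN F R ι h h.length ρ φ) := by
  obtain ⟨hev⟩ : Nonempty (Computable₂ (evr (fcalls ι) (fcomb F R (ι 0)) false)) :=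
    ⟨evr_computable false (fcalls_computable hιc) (fcomb_computable F R (ι 0) hF hR)⟩
  refine ⟨fun n => evr (fcalls ι) (fcomb F R (ι 0)) false (n.unpair.2 + 1)
    ((dh n.unpair.1, []), (dh (C := C) n.unpair.1).length, n.unpair.2), ?_, ?_⟩
  · have h1 : Primrec fun n : ℕ => dh (C := C) n.unpair.1 := dh_primrec.comp un1
    have h2 : Primrec fun n : ℕ => (((dh n.unpair.1, []), (dh (C := C) n.unpair.1).length,
        n.unpair.2) : St C) :=
      (h1.pair (Primrec.const [])).pair ((Primrec.list_length.comp h1).pair un2)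
    exact hev.comp (Primrec.succ.comp un2).to_comp h2.to_comp
  · intro h φ _ hcl _
    simp only [Nat.unpair_pair]
    rw [dh_length, fev_aux F R ι (ι 0) h _ (dh_mem h) _ φ _ _ (Nat.lt_succ_self _)]
    constructor
    · intro hs ρ
      refine (SatN_congr F R ι h φ _ _ _ ?_).1 hs
      intro v hv
      rw [show φ.fv = [] from hcl] at hv
      simp at hv
    · intro hs
      exact hs _
end

section
/- Let the constants range over ℤ and let the term language contain standard integer polynomial arithmetic (+, ×, integer constants) with the interpreted relation =. Then the potential satisfiability problem is undecidable: there is no computable function which, given (under the natural encodings) a po-history h, an index i, and a closed formula ψ, returns true if (h,i) ⊢ ψ and false otherwise. -/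
/-- A partially observable session: a finite set of atoms `p(u₁,…,uₙ)` where each
argument is either a variable (`Sum.inl`) or a constant (`Sum.inr`). -/
abbrev PoSession (C : Type) := Finset (ℕ × List (ℕ ⊕ C))

/-- A partially observable history. -/
abbrev PoHistory (C : Type) := List (PoSession C)

/-- Applying a substitution `σ` to a po-history yields an ordinary history. -/
def applySub {C : Type} [DecidableEq C] (σ : ℕ → C) (h : PoHistory C) : History C :=
  h.map fun s => s.image fun e => (e.1, e.2.map (Sum.elim σ id))

/-- `h` potentially satisfies the closed formula `ψ` at `i`: some substitution for the
unknowns of `h` makes `ψ` true at `(hσ, i)`. -/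
def PotSat {C : Type} [DecidableEq C] (F : ℕ → List C → C) (R : ℕ → List C → Bool)
    (h : PoHistory C) (i : ℕ) (ψ : Fm C) : Prop :=
  ∃ σ : ℕ → C, ∀ ρ : ℕ → C, Sat F R (applySub σ h) i ρ ψ

/-- `h` adheres to the closed formula `ψ` at `i`: every substitution for the unknowns of
`h` makes `ψ` true at `(hσ, i)`. -/
def Adheres {C : Type} [DecidableEq C] (F : ℕ → List C → C) (R : ℕ → List C → Bool)
    (h : PoHistory C) (i : ℕ) (ψ : Fm C) : Prop :=
  ∀ σ : ℕ → C, ∀ ρ : ℕ → C, Sat F R (applySub σ h) i ρ ψ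

/- ===== Part 1: arithmetic ===== -/

theorem mrdp_digit (B : ℕ) (hB : 0 < B) : ∀ (n k : ℕ) (a : ℕ → ℕ), (∀ i, a i < B) →
    (∑ i ∈ Finset.range n, a i * B ^ i) / B ^ k % B = if k < n then a k else 0 := by
  intro n
  induction n with
  | zero => intro k a _; simp
  | succ n ih =>
    intro k a ha
    have e : ∑ i ∈ Finset.range (n + 1), a i * B ^ i
        = a 0 + B * ∑ i ∈ Finset.range n, a (i + 1) * B ^ i := by
      rw [Finset.sum_range_succ', Finset.mul_sum, add_comm]
      congr 1
      · simp
      · refine Finset.sum_congr rfl fun i _ => ?_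
        ring
    rw [e]
    cases k with
    | zero => simp [Nat.mod_eq_of_lt (ha 0)]
    | succ k =>
      rw [pow_succ', ← Nat.div_div_eq_div_mul, Nat.add_mul_div_left _ _ hB,
        Nat.div_eq_of_lt (ha 0), zero_add, ih k (fun i => a (i + 1)) (fun i => ha _)]
      simp

theorem mrdp_choose_eq (n k : ℕ) :
    n.choose k = (2 ^ (n + 1) + 1) ^ n / (2 ^ (n + 1)) ^ k % 2 ^ (n + 1) := by
  have h := mrdp_digit (2 ^ (n + 1)) (by positivity) (n + 1) k (fun i => n.choose i) (fun i => by
    have h1 := Nat.choose_le_two_pow n i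
    have h2 : 2 ^ n < 2 ^ (n + 1) := Nat.pow_lt_pow_right (by norm_num) (by omega)
    omega)
  have e : (2 ^ (n + 1) + 1) ^ n
      = ∑ i ∈ Finset.range (n + 1), n.choose i * (2 ^ (n + 1)) ^ i := by
    rw [add_pow]
    refine Finset.sum_congr rfl fun i _ => ?_
    simp [mul_comm]
  rw [e, h]
  split_ifs with hk
  · rfl
  · exact Nat.choose_eq_zero_of_lt (by omega)

theorem mrdp_factorial_eq (n : ℕ) :
    n.factorial = ((n ^ n + 1) * n ^ 2 + 1) ^ n / ((n ^ n + 1) * n ^ 2 + 1).choose n := by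
  set r := (n ^ n + 1) * n ^ 2 + 1 with hr
  have hnr : n ≤ r := by
    have : n ≤ n ^ 2 := Nat.le_self_pow (by norm_num) n
    nlinarith [Nat.zero_le (n ^ n * n ^ 2)]
  have hD : r.descFactorial n = n.factorial * r.choose n := Nat.descFactorial_eq_factorial_mul_choose r n
  have h1 : r.descFactorial n ≤ r ^ n := Nat.descFactorial_le_pow r n
  have h2 : (r - n) ^ n ≤ r.descFactorial n :=
    le_trans (Nat.pow_le_pow_left (by omega) n) (Nat.pow_sub_le_descFactorial r n)
  have hf : n.factorial ≤ n ^ n := Nat.factorial_le_pow n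
  symm
  apply Nat.div_eq_of_lt_le
  · rw [← hD]; exact h1
  have hfp : 0 < n.factorial := Nat.factorial_pos n
  refine Nat.lt_of_mul_lt_mul_left (a := n.factorial) ?_
  have : n.factorial * ((n.factorial + 1) * r.choose n) = (n.factorial + 1) * r.descFactorial n := by
    rw [hD]; ring
  rw [this]
  have hr0 : (0 : ℝ) < r := by rw [hr]; positivity
  have key : (r : ℝ) ^ n * (r - n ^ 2) ≤ r * r.descFactorial n := by
    have hb := one_add_mul_le_pow (a := -(n : ℝ) / r) (by
      have : (n : ℝ) / r ≤ 1 := (div_le_one hr0).2 (by exact_mod_cast hnr)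
      rw [neg_div]; linarith) n
    have e1 : (r : ℝ) ^ n * (1 + -(n : ℝ) / r) ^ n = ((r - n : ℕ) : ℝ) ^ n := by
      rw [← mul_pow, Nat.cast_sub hnr]; congr 1; field_simp; ring
    have e2 : (r : ℝ) * (1 + n * (-(n : ℝ) / r)) = r - n ^ 2 := by field_simp; ring
    have h2' : (((r - n : ℕ) : ℝ)) ^ n ≤ r.descFactorial n := by exact_mod_cast h2
    calc (r : ℝ) ^ n * (r - n ^ 2) = r * (r ^ n * (1 + n * (-(n : ℝ) / r))) := by rw [← e2]; ring
      _ ≤ r * (r ^ n * (1 + -(n : ℝ) / r) ^ n) := by gcongr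
      _ = r * ((r - n : ℕ) : ℝ) ^ n := by rw [e1]
      _ ≤ _ := by gcongr
  have hfr : ((n.factorial : ℝ) + 1) * n ^ 2 < r := by
    have : (n.factorial + 1) * n ^ 2 < r := by rw [hr]; nlinarith [Nat.zero_le (n ^ 2)]
    exact_mod_cast this
  have hpos : (0 : ℝ) < (r : ℝ) ^ n := by positivity
  have : (r : ℝ) * (n.factorial * r ^ n) < r * ((n.factorial + 1) * r.descFactorial n) := by
    have a1 : ((n.factorial : ℝ) + 1) * (r ^ n * (r - n ^ 2))
        ≤ (n.factorial + 1) * (r * r.descFactorial n) := by gcongr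
    nlinarith
  have := lt_of_mul_lt_mul_left this hr0.le
  exact_mod_cast this

/-- moduli -/
def mrdpMod (Q k : ℕ) : ℕ := Q.factorial * (Q.factorial / (k + 1)) - 1

theorem mrdp_mod_spec {Q k : ℕ} (hk : k < Q) :
    (k + 1) * mrdpMod Q k = Q.factorial * Q.factorial - 1 - k := by
  have hd : (k + 1) * (Q.factorial / (k + 1)) = Q.factorial :=
    Nat.mul_div_cancel' (Nat.dvd_factorial (by omega) (by omega))
  have : (k + 1) * (Q.factorial * (Q.factorial / (k + 1))) = Q.factorial * Q.factorial := by
    rw [mul_left_comm, hd]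
  rw [mrdpMod, Nat.mul_sub, this]
  omega

theorem mrdp_mod_succ {Q k : ℕ} (hk : k < Q) :
    mrdpMod Q k + 1 = Q.factorial * (Q.factorial / (k + 1)) := by
  have hd : (k + 1) * (Q.factorial / (k + 1)) = Q.factorial :=
    Nat.mul_div_cancel' (Nat.dvd_factorial (by omega) (by omega))
  have h1 := Nat.factorial_pos Q
  have h2 : 0 < Q.factorial / (k + 1) := by
    rcases Nat.eq_zero_or_pos (Q.factorial / (k + 1)) with h | h
    · rw [h] at hd; omega
    · exact h
  have := Nat.mul_pos h1 h2
  rw [mrdpMod]; omega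

theorem mrdp_mod_coprime_fact {Q k : ℕ} (hk : k < Q) : (mrdpMod Q k).Coprime Q.factorial := by
  have h := mrdp_mod_succ hk
  have h1 : (mrdpMod Q k).Coprime (mrdpMod Q k + 1) := by simp
  rw [h] at h1
  exact Nat.Coprime.coprime_mul_right_right h1

theorem mrdp_mod_ne_one {Q k : ℕ} (h3 : 3 ≤ Q) (hk : k < Q) : mrdpMod Q k ≠ 1 := by
  intro h
  have h1 := mrdp_mod_succ hk
  rw [h] at h1
  have h2 : Q.factorial ∣ 2 := ⟨_, h1⟩
  have h4 := Nat.le_of_dvd (by norm_num) h2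
  have h5 := Nat.self_le_factorial Q
  omega

theorem mrdp_prime_gt {Q k p : ℕ} (hk : k < Q) (hp : p.Prime) (hd : p ∣ mrdpMod Q k) : Q < p := by
  by_contra hle
  have h1 : p ∣ Q.factorial := (Nat.Prime.dvd_factorial hp).2 (by omega)
  exact hp.one_lt.ne' (Nat.eq_one_of_dvd_coprimes (mrdp_mod_coprime_fact hk) hd h1)

theorem mrdp_mod_modEq {Q k : ℕ} (hk : k < Q) :
    Q.factorial * Q.factorial - 1 ≡ k [MOD mrdpMod Q k] := by
  have h := mrdp_mod_spec hk
  have h5 := Nat.self_le_factorial Q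
  have h6 : Q ≤ Q.factorial * Q.factorial := by nlinarith [Nat.factorial_pos Q]
  have h7 : Q.factorial * Q.factorial - 1 = k + mrdpMod Q k * (k + 1) := by
    rw [mul_comm (mrdpMod Q k), h]; omega
  rw [h7]
  simp [Nat.ModEq]

theorem mrdp_mod_coprime {Q k l : ℕ} (hk : k < Q) (hl : l < Q) (hkl : k ≠ l) :
    (mrdpMod Q k).Coprime (mrdpMod Q l) := by
  apply Nat.Coprime.symm
  rw [Nat.coprime_iff_gcd_eq_one]
  by_contra hne
  obtain ⟨p, hp, hd⟩ := Nat.exists_prime_and_dvd hne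
  have h1 := hd.trans (Nat.gcd_dvd_right _ _)
  have h2 := hd.trans (Nat.gcd_dvd_left _ _)
  have hgt := mrdp_prime_gt hk hp h1
  have e : k ≡ l [MOD p] := ((mrdp_mod_modEq hk).of_dvd h1).symm.trans ((mrdp_mod_modEq hl).of_dvd h2)
  exact hkl (Nat.ModEq.eq_of_lt_of_lt e (by omega) (by omega))

theorem mrdp_prod_mod {Q y : ℕ} (hy : y ≤ Q) :
    (Q.factorial * Q.factorial - 1).choose y = ∏ k ∈ Finset.range y, mrdpMod Q k := by
  have h := Nat.descFactorial_eq_factorial_mul_choose (Q.factorial * Q.factorial - 1) y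
  rw [Nat.descFactorial_eq_prod_range] at h
  have h2 : ∏ k ∈ Finset.range y, (Q.factorial * Q.factorial - 1 - k)
      = ∏ k ∈ Finset.range y, ((k + 1) * mrdpMod Q k) :=
    Finset.prod_congr rfl fun k hk => (mrdp_mod_spec (by simp at hk; omega)).symm
  rw [h2, Finset.prod_mul_distrib, Finset.prod_range_add_one_eq_factorial] at h
  exact (Nat.eq_of_mul_eq_mul_left (Nat.factorial_pos y) h).symm

theorem mrdp_dvd_choose {p a u : ℕ} (hp : p.Prime) (h : p ∣ a.choose u) (hup : u ≤ p) : a % p < u := by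
  have h1 : p ∣ a.descFactorial u := by
    rw [Nat.descFactorial_eq_factorial_mul_choose]; exact h.mul_left _
  rw [Nat.descFactorial_eq_prod_range] at h1
  obtain ⟨i, hi, hd⟩ := (hp.prime.dvd_finsetProd_iff _).1 h1
  simp at hi
  by_cases hai : i ≤ a
  · have : i ≡ a [MOD p] := (Nat.modEq_iff_dvd' hai).2 hd
    rw [← this, Nat.mod_eq_of_lt (by omega)]
    exact hi
  · exact lt_of_le_of_lt (Nat.mod_le _ _) (by omega)

theorem mrdp_dvd_desc {m a u j : ℕ} (hj : j < u) (h : a ≡ j [MOD m]) : m ∣ a.descFactorial u := by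
  by_cases ha : a < u
  · rw [Nat.descFactorial_eq_zero_iff_lt.2 ha]; simp
  · rw [Nat.descFactorial_eq_prod_range]
    refine dvd_trans ?_ (Finset.dvd_prod_of_mem _ (Finset.mem_range.2 hj))
    exact (Nat.modEq_iff_dvd' (by omega)).1 h.symm

/- ===== Part 2: Diophantine closure properties ===== -/

section MRDP
open Dioph

variable {α : Type}

theorem mrdp_ex {P : (α → ℕ) → ℕ → Prop} (h : Dioph {v : Option α → ℕ | P (v ∘ some) (v none)}) :
    Dioph {v | ∃ x, P v x} :=
  Dioph.ext (ex1_dioph h) fun v => by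
    simp only [Set.mem_ofPred_eq]
    rfl

theorem mrdp_some {f : (α → ℕ) → ℕ} (h : DiophFn f) :
    DiophFn (fun v : Option α → ℕ => f (v ∘ some)) := reindex_diophFn some h

theorem mrdp_and {P Q : (α → ℕ) → Prop} (h : Dioph {v | P v}) (h' : Dioph {v | Q v}) :
    Dioph {v | P v ∧ Q v} := h.inter h'

theorem mrdp_or {P Q : (α → ℕ) → Prop} (h : Dioph {v | P v}) (h' : Dioph {v | Q v}) :
    Dioph {v | P v ∨ Q v} := h.union h'

theorem mrdp_const (n : ℕ) : DiophFn (fun _ : α → ℕ => n) := const_dioph n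

theorem mrdp_choose {f g : (α → ℕ) → ℕ} (hf : DiophFn f) (hg : DiophFn g) :
    DiophFn (fun v => (f v).choose (g v)) := by
  simp only [mrdp_choose_eq]
  have hB := pow_dioph (mrdp_const 2) (add_dioph hf (mrdp_const 1))
  exact mod_dioph (div_dioph (pow_dioph (add_dioph hB (mrdp_const 1)) hf) (pow_dioph hB hg)) hB

theorem mrdp_factorial {f : (α → ℕ) → ℕ} (hf : DiophFn f) :
    DiophFn (fun v => (f v).factorial) := by
  simp only [mrdp_factorial_eq]
  have hr := add_dioph (mul_dioph (add_dioph (pow_dioph hf hf) (mrdp_const 1))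
    (pow_dioph hf (mrdp_const 2))) (mrdp_const 1)
  exact div_dioph (pow_dioph hr hf) (mrdp_choose hr hf)

theorem mrdp_poly_comp {γ : Type} {f : (γ → ℕ) → ℤ} (hf : IsPoly f) (s : γ → (α → ℕ) → ℕ)
    (hs : ∀ i, DiophFn (s i)) :
    ∃ A B : (α → ℕ) → ℕ, DiophFn A ∧ DiophFn B ∧
      ∀ v, f (fun i => s i v) = (A v : ℤ) - B v := by
  induction hf with
  | proj i => exact ⟨s i, fun _ => 0, hs i, mrdp_const 0, fun v => by simp⟩
  | const n =>
    refine ⟨fun _ => n.toNat, fun _ => (-n).toNat, mrdp_const _, mrdp_const _, fun v => by simp⟩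
  | sub _ _ ih1 ih2 =>
    obtain ⟨A, B, hA, hB, h⟩ := ih1
    obtain ⟨A', B', hA', hB', h'⟩ := ih2
    refine ⟨_, _, add_dioph hA hB', add_dioph hB hA', fun v => ?_⟩
    simp only [h, h']; push_cast; ring
  | mul _ _ ih1 ih2 =>
    obtain ⟨A, B, hA, hB, h⟩ := ih1
    obtain ⟨A', B', hA', hB', h'⟩ := ih2
    refine ⟨_, _, add_dioph (mul_dioph hA hA') (mul_dioph hB hB'),
      add_dioph (mul_dioph hA hB') (mul_dioph hB hA'), fun v => ?_⟩
    simp only [h, h']; push_cast; ring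

theorem mrdp_natAbs {γ : Type} {f : (γ → ℕ) → ℤ} (hf : IsPoly f) (s : γ → (α → ℕ) → ℕ)
    (hs : ∀ i, DiophFn (s i)) : DiophFn (fun v => (f (fun i => s i v)).natAbs) := by
  obtain ⟨A, B, hA, hB, h⟩ := mrdp_poly_comp hf s hs
  have e : (fun v => (f (fun i => s i v)).natAbs) = fun v => (A v - B v) + (B v - A v) := by
    funext v; rw [h]; omega
  rw [e]
  exact add_dioph (sub_dioph hA hB) (sub_dioph hB hA)

theorem mrdp_bound {γ : Type} {f : (γ → ℕ) → ℤ} (hf : IsPoly f) (s : γ → (α → ℕ) → ℕ)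
    (hs : ∀ i, DiophFn (s i)) :
    ∃ g : (α → ℕ) → ℕ, DiophFn g ∧ ∀ v x, (∀ i, x i ≤ s i v) → (f x).natAbs ≤ g v := by
  induction hf with
  | proj i => exact ⟨s i, hs i, fun v x h => by simpa using h i⟩
  | const n => exact ⟨fun _ => n.natAbs, mrdp_const _, fun v x h => le_rfl⟩
  | sub _ _ ih1 ih2 =>
    obtain ⟨A, hA, h⟩ := ih1
    obtain ⟨A', hA', h'⟩ := ih2
    refine ⟨_, add_dioph hA hA', fun v x hx => ?_⟩
    have := h v x hx
    have := h' v x hx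
    dsimp only
    omega
  | mul _ _ ih1 ih2 =>
    obtain ⟨A, hA, h⟩ := ih1
    obtain ⟨A', hA', h'⟩ := ih2
    refine ⟨_, mul_dioph hA hA', fun v x hx => ?_⟩
    rw [Int.natAbs_mul]
    exact Nat.mul_le_mul (h v x hx) (h' v x hx)

theorem mrdp_poly_modEq {γ : Type} {f : (γ → ℕ) → ℤ} (hf : IsPoly f) (m : ℕ) (x x' : γ → ℕ)
    (h : ∀ i, x i ≡ x' i [MOD m]) : f x ≡ f x' [ZMOD m] := by
  induction hf with
  | proj i => exact Int.natCast_modEq_iff.2 (h i)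
  | const n => exact Int.ModEq.refl _
  | sub _ _ ih1 ih2 => exact ih1.sub ih2
  | mul _ _ ih1 ih2 => exact ih1.mul ih2

theorem mrdp_poly_support {γ : Type} {f : (γ → ℕ) → ℤ} (hf : IsPoly f) :
    ∃ s : Finset γ, ∀ x x' : γ → ℕ, (∀ i ∈ s, x i = x' i) → f x = f x' := by
  classical
  induction hf with
  | proj i => exact ⟨{i}, fun x x' h => by simp [h i (by simp)]⟩
  | const n => exact ⟨∅, fun x x' h => rfl⟩
  | sub _ _ ih1 ih2 =>
    obtain ⟨s, h⟩ := ih1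
    obtain ⟨s', h'⟩ := ih2
    exact ⟨s ∪ s', fun x x' hx => by
      simp only
      rw [h x x' fun i hi => hx i (Finset.mem_union_left _ hi),
        h' x x' fun i hi => hx i (Finset.mem_union_right _ hi)]⟩
  | mul _ _ ih1 ih2 =>
    obtain ⟨s, h⟩ := ih1
    obtain ⟨s', h'⟩ := ih2
    exact ⟨s ∪ s', fun x x' hx => by
      simp only
      rw [h x x' fun i hi => hx i (Finset.mem_union_left _ hi),
        h' x x' fun i hi => hx i (Finset.mem_union_right _ hi)]⟩

theorem mrdp_finite {S : Set (α → ℕ)} (h : Dioph S) :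
    ∃ (β : Type) (_ : Fintype β) (p : Poly (α ⊕ β)), ∀ v, v ∈ S ↔ ∃ t, p (Sum.elim v t) = 0 := by
  classical
  obtain ⟨β, p, hp⟩ := h
  obtain ⟨s, hs⟩ := mrdp_poly_support p.isPoly
  let s' : Finset β := s.preimage Sum.inr (Sum.inr_injective.injOn)
  let φ : β → Option s' := fun b => if h : b ∈ s' then some ⟨b, h⟩ else none
  refine ⟨Option s', inferInstance, p.map (Sum.map id φ), fun v => (hp v).trans ⟨?_, ?_⟩⟩
  · rintro ⟨t, ht⟩
    refine ⟨fun o => o.elim 0 (fun b => t b), ?_⟩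
    rw [Poly.map_apply, ← ht]
    refine hs _ _ fun i hi => ?_
    rcases i with i | i
    · rfl
    · have : i ∈ s' := by simpa [s'] using hi
      simp [φ, this]
  · rintro ⟨t, ht⟩
    refine ⟨t ∘ φ, ?_⟩
    rw [Poly.map_apply] at ht
    rw [← ht]
    congr 1
    funext i
    rcases i with i | i <;> rfl

theorem mrdp_forall_finite {ι : Type} [Fintype ι] {P : ι → (α → ℕ) → Prop}
    (h : ∀ i, Dioph {v | P i v}) : Dioph {v | ∀ i, P i v} := by
  classical
  have : ∀ s : Finset ι, Dioph {v | ∀ i ∈ s, P i v} := by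
    intro s
    induction s using Finset.induction_on with
    | empty =>
      exact Dioph.ext (eq_dioph (mrdp_const 0) (mrdp_const 0)) fun v => by simp
    | insert a s _ ih =>
      exact Dioph.ext (mrdp_and (h a) ih) fun v => by simp
  exact Dioph.ext (this Finset.univ) fun v => by simp

theorem mrdp_ball {P : (α → ℕ) → ℕ → Prop}
    (h : Dioph {v : Option α → ℕ | P (v ∘ some) (v none)}) {y : (α → ℕ) → ℕ} (hy : DiophFn y) :
    Dioph {v | ∀ k < y v, P v k} := by
  classical
  obtain ⟨β, _, p, hp⟩ := mrdp_finite h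
  have hP : ∀ v k, P v k ↔ ∃ t, p (Sum.elim (fun o : Option α => o.elim k v) t) = 0 :=
    fun v k => hp (fun o : Option α => o.elim k v)
  -- variables of the new set: `inl none` is `u`, `inl (some a)` is `v`, `inr b` is `a`
  have hy' : DiophFn (fun w : Option α ⊕ β → ℕ => y (w ∘ Sum.inl ∘ some)) := reindex_diophFn _ hy
  have hu : DiophFn (fun w : Option α ⊕ β → ℕ => w (Sum.inl none)) := proj_dioph _
  obtain ⟨g, hg0, hgb⟩ := mrdp_bound (α := Option α) p.isPoly
    (Sum.elim (fun o : Option α => o.elim (fun w => y (w ∘ some))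
      (fun a w => w (some a))) (fun _ w => w none))
    (by rintro ((_ | a) | b); exacts [mrdp_some hy, proj_dioph _, proj_dioph _])
  have hg : DiophFn (fun w : Option α ⊕ β → ℕ => g (w ∘ Sum.inl)) := reindex_diophFn _ hg0
  set Q : (Option α ⊕ β → ℕ) → ℕ := fun w =>
    y (w ∘ Sum.inl ∘ some) + w (Sum.inl none) + g (w ∘ Sum.inl) + 3 with hQ
  have dQ : DiophFn Q := add_dioph (add_dioph (add_dioph hy' hu) hg) (mrdp_const 3)
  set c : (Option α ⊕ β → ℕ) → ℕ := fun w => (Q w).factorial * (Q w).factorial - 1 with hc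
  have dc : DiophFn c :=
    sub_dioph (mul_dioph (mrdp_factorial dQ) (mrdp_factorial dQ)) (mrdp_const 1)
  set N : (Option α ⊕ β → ℕ) → ℕ := fun w => (c w).choose (y (w ∘ Sum.inl ∘ some)) with hN
  have dN : DiophFn N := mrdp_choose dc hy'
  have d1 : Dioph {w : Option α ⊕ β → ℕ |
      ∀ b : β, N w ∣ (w (Sum.inr b)).choose (w (Sum.inl none))} :=
    mrdp_forall_finite fun b => dvd_dioph dN (mrdp_choose (proj_dioph _) hu)
  have d2 := dvd_dioph dN (mrdp_natAbs (α := Option α ⊕ β) p.isPoly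
    (Sum.elim (fun o : Option α => o.elim c (fun a w => w (Sum.inl (some a))))
      (fun b w => w (Sum.inr b)))
    (by rintro ((_ | a) | b); exacts [dc, proj_dioph _, proj_dioph _]))
  have d3 := ex1_dioph (ex_dioph (mrdp_and d1 d2))
  refine Dioph.ext d3 fun v => ?_
  simp only [Set.mem_ofPred_eq]
  constructor
  · rintro ⟨u, a, h1, h2⟩ k hk
    set w : Option α ⊕ β → ℕ := Sum.elim (Option.elim' u v) a with hw
    have hwy : y (w ∘ Sum.inl ∘ some) = y v := rfl
    have hwu : w (Sum.inl none) = u := rfl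
    have hkQ : k < Q w := by simp only [hQ]; omega
    obtain ⟨q, hq, hqd⟩ := Nat.exists_prime_and_dvd
      (mrdp_mod_ne_one (Q := Q w) (k := k) (by simp only [hQ]; omega) hkQ)
    have hqQ : Q w < q := mrdp_prime_gt hkQ hq hqd
    have hqN : q ∣ N w := by
      refine hqd.trans ?_
      simp only [hN, hc]
      rw [mrdp_prod_mod (by simp only [hQ]; omega)]
      exact Finset.dvd_prod_of_mem _ (Finset.mem_range.2 hk)
    have hz : ∀ b, a b % q < u := fun b =>
      mrdp_dvd_choose hq (hqN.trans (h1 b)) (by simp only [hQ] at hqQ; omega)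
    rw [hP]
    refine ⟨fun b => a b % q, ?_⟩
    have hbd := hgb (w ∘ Sum.inl) (Sum.elim (fun o : Option α => o.elim k v) (fun b => a b % q)) (by
      rintro ((_ | i) | b)
      · exact hk.le
      · exact le_rfl
      · exact (hz b).le)
    have hmod := mrdp_poly_modEq p.isPoly q
      (Sum.elim (fun o : Option α => o.elim k v) (fun b => a b % q))
      (fun i => Sum.elim (fun o : Option α => o.elim c (fun a w => w (Sum.inl (some a))))
        (fun b w => w (Sum.inr b)) i w) (by
      rintro ((_ | i) | b)
      · exact ((mrdp_mod_modEq hkQ).of_dvd hqd).symm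
      · exact Nat.ModEq.refl _
      · exact Nat.mod_modEq _ _)
    have h0 := (Int.natCast_dvd.2 (hqN.trans h2))
    have h4 := (Int.ModEq.dvd_iff hmod).2 h0
    have h5 := Int.natCast_dvd.1 h4
    refine Int.natAbs_eq_zero.1 (Nat.eq_zero_of_dvd_of_lt h5 (lt_of_le_of_lt hbd ?_))
    simp only [hQ] at hqQ; omega
  · intro hall
    have hall' : ∀ k : ℕ, ∃ t : β → ℕ, k < y v →
        p (Sum.elim (fun o : Option α => o.elim k v) t) = 0 := by
      intro k
      by_cases hk : k < y v
      · obtain ⟨t, ht⟩ := (hP v k).1 (hall k hk)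
        exact ⟨t, fun _ => ht⟩
      · exact ⟨0, fun h => absurd h hk⟩
    choose t ht using hall'
    let u : ℕ := (∑ k ∈ Finset.range (y v), ∑ b, t k b) + 1
    have htu : ∀ k < y v, ∀ b, t k b < u := by
      intro k hk b
      have h1 : t k b ≤ ∑ b, t k b := Finset.single_le_sum (f := t k) (fun _ _ => Nat.zero_le _)
        (Finset.mem_univ b)
      have h2 : ∑ b, t k b ≤ ∑ k ∈ Finset.range (y v), ∑ b, t k b :=
        Finset.single_le_sum (f := fun k => ∑ b, t k b) (fun _ _ => Nat.zero_le _)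
        (Finset.mem_range.2 hk)
      simp only [u]; omega
    let Qv : ℕ := y v + u + g (Option.elim' u v) + 3
    have hyQ : y v ≤ Qv := by simp only [Qv]; omega
    have hne : ∀ k ∈ Finset.range (y v), mrdpMod Qv k ≠ 0 := by
      intro k hk h0
      have hc := mrdp_mod_coprime_fact (Q := Qv) (k := k)
        (lt_of_lt_of_le (Finset.mem_range.1 hk) hyQ)
      rw [h0, Nat.coprime_zero_left] at hc
      have := Nat.self_le_factorial Qv
      simp only [Qv] at this hc
      omega
    have hpw : ∀ k < y v, ∀ l < y v, k ≠ l → (mrdpMod Qv k).Coprime (mrdpMod Qv l) :=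
      fun k hk l hl hkl => mrdp_mod_coprime (by omega) (by omega) hkl
    have hcrt : ∀ b, ∃ x : ℕ, ∀ k < y v, x ≡ t k b [MOD mrdpMod Qv k] := by
      intro b
      obtain ⟨x, hx⟩ := Nat.chineseRemainderOfFinset (fun k => t k b) (mrdpMod Qv)
        (Finset.range (y v)) hne (fun k hk l hl hkl =>
          hpw k (by simpa using hk) l (by simpa using hl) hkl)
      exact ⟨x, fun k hk => hx k (Finset.mem_range.2 hk)⟩
    choose a ha using hcrt
    refine ⟨u, a, ?_⟩
    set w : Option α ⊕ β → ℕ := Sum.elim (Option.elim' u v) a with hw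
    have hQw : Q w = Qv := rfl
    have hNw : N w = ∏ k ∈ Finset.range (y v), mrdpMod Qv k := mrdp_prod_mod hyQ
    constructor
    · intro b
      change N w ∣ (a b).choose u
      rw [hNw]
      have hcop : (∏ k ∈ Finset.range (y v), mrdpMod Qv k).Coprime u.factorial := by
        refine Nat.Coprime.prod_left fun k hk => ?_
        refine Nat.Coprime.of_dvd_right (Nat.factorial_dvd_factorial (n := Qv) ?_)
          (mrdp_mod_coprime_fact (lt_of_lt_of_le (Finset.mem_range.1 hk) hyQ))
        simp only [Qv]; omega
      refine hcop.dvd_of_dvd_mul_left ?_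
      rw [← Nat.descFactorial_eq_factorial_mul_choose]
      refine Finset.prod_dvd_of_isRelPrime ?_ fun k hk => ?_
      · intro k hk l hl hkl
        exact Nat.coprime_iff_isRelPrime.1 (hpw k (by simpa using hk) l (by simpa using hl) hkl)
      · have hk' := Finset.mem_range.1 hk
        exact mrdp_dvd_desc (htu k hk' b) (ha b k hk')
    · rw [hNw]
      refine Finset.prod_dvd_of_isRelPrime ?_ fun k hk => ?_
      · intro k hk l hl hkl
        exact Nat.coprime_iff_isRelPrime.1 (hpw k (by simpa using hk) l (by simpa using hl) hkl)
      · have hk' := Finset.mem_range.1 hk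
        have hmod := mrdp_poly_modEq p.isPoly (mrdpMod Qv k)
          (Sum.elim (fun o : Option α => o.elim k v) (t k))
          (fun i => Sum.elim (fun o : Option α => o.elim c (fun a w => w (Sum.inl (some a))))
            (fun b w => w (Sum.inr b)) i w) (by
          rintro ((_ | i) | b)
          · exact (mrdp_mod_modEq (lt_of_lt_of_le hk' hyQ)).symm
          · exact Nat.ModEq.refl _
          · exact (ha b k hk').symm)
        rw [ht k hk'] at hmod
        exact Int.natCast_dvd.1 ((Int.ModEq.dvd_iff hmod).1 (dvd_zero _))


theorem mrdp_none : DiophFn (fun v : Option α → ℕ => v none) := proj_dioph _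

theorem mrdp_pair {f g : (α → ℕ) → ℕ} (hf : DiophFn f) (hg : DiophFn g) :
    DiophFn (fun v => Nat.pair (f v) (g v)) := by
  have hf' := mrdp_some hf
  have hg' := mrdp_some hg
  have h0 : DiophFn (fun v : Option α → ℕ => v none) := mrdp_none
  have := mrdp_or (mrdp_and (lt_dioph hf' hg') (eq_dioph (add_dioph (mul_dioph hg' hg') hf') h0))
    (mrdp_and (le_dioph hg' hf')
      (eq_dioph (add_dioph (add_dioph (mul_dioph hf' hf') hf') hg') h0))
  refine Dioph.ext this fun v => ?_
  simp only [Set.mem_ofPred_eq, Nat.pair]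
  split_ifs with h
  · simp [h]
  · simp [h, Nat.le_of_not_lt h]

theorem mrdp_rec_iff (f g : ℕ →. ℕ) (a n b : ℕ) :
    (b ∈ (Nat.rec (f a) (fun y IH => do let i ← IH; g (Nat.pair a (Nat.pair y i))) n : Part ℕ)) ↔
      ∃ s : ℕ → ℕ, s 0 ∈ f a ∧ (∀ k < n, s (k + 1) ∈ g (Nat.pair a (Nat.pair k (s k)))) ∧ s n = b := by
  induction n generalizing b with
  | zero =>
    constructor
    · intro h; exact ⟨fun _ => b, h, by simp, rfl⟩
    · rintro ⟨s, h, _, rfl⟩; exact h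
  | succ n ih =>
    constructor
    · intro h
      obtain ⟨i, hi, hb⟩ := Part.mem_bind_iff.1 h
      obtain ⟨s, h0, hs, rfl⟩ := (ih i).1 hi
      refine ⟨fun k => if k ≤ n then s k else b, by simpa using h0, fun k hk => ?_, by simp⟩
      by_cases hkn : k < n
      · have := hs k hkn
        simpa [Nat.succ_le_of_lt hkn, hkn.le] using this
      · have : k = n := by omega
        subst this
        simpa using hb
    · rintro ⟨s, h0, hs, rfl⟩
      exact Part.mem_bind_iff.2 ⟨s n, (ih _).2 ⟨s, h0, fun k hk => hs k (by omega), rfl⟩,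
        hs n (by omega)⟩

theorem mrdp_beta (s : ℕ → ℕ) (n : ℕ) :
    ∃ x y : ℕ, ∀ k ≤ n, x % ((k + 1) * y + 1) = s k := by
  let l := (List.range (n + 1)).map s
  refine ⟨(Nat.unbeta l).unpair.1, (Nat.unbeta l).unpair.2, fun k hk => ?_⟩
  have := Nat.beta_unbeta_coe l ⟨k, by simp [l]; omega⟩
  simpa [Nat.beta, l] using this

theorem mrdp_rec_iff' (f g : ℕ →. ℕ) (a n b : ℕ) :
    (b ∈ (Nat.rec (f a) (fun y IH => do let i ← IH; g (Nat.pair a (Nat.pair y i))) n : Part ℕ)) ↔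
      ∃ x y : ℕ, x % ((0 + 1) * y + 1) ∈ f a ∧
        (∀ k < n, x % ((k + 1 + 1) * y + 1) ∈
          g (Nat.pair a (Nat.pair k (x % ((k + 1) * y + 1))))) ∧ x % ((n + 1) * y + 1) = b := by
  rw [mrdp_rec_iff]
  constructor
  · rintro ⟨s, h0, hs, rfl⟩
    obtain ⟨x, y, h⟩ := mrdp_beta s n
    refine ⟨x, y, ?_, fun k hk => ?_, h n le_rfl⟩
    · rw [h 0 (Nat.zero_le _)]; exact h0
    · rw [h (k + 1) hk, h k hk.le]; exact hs k hk
  · rintro ⟨x, y, h0, hs, h⟩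
    exact ⟨fun k => x % ((k + 1) * y + 1), h0, hs, h⟩

theorem mrdp_partrec {f : ℕ →. ℕ} (hf : Nat.Partrec f) :
    ∀ {α : Type} {a b : (α → ℕ) → ℕ}, DiophFn a → DiophFn b → Dioph {v | b v ∈ f (a v)} := by
  induction hf with
  | zero =>
    intro α a b ha hb
    exact Dioph.ext (eq_dioph hb (mrdp_const 0)) fun v => by
      change _ ↔ b v ∈ Part.some 0
      simp
  | succ =>
    intro α a b ha hb
    exact Dioph.ext (eq_dioph hb (add_dioph ha (mrdp_const 1))) fun v => by
      simp
  | left =>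
    intro α a b ha hb
    refine Dioph.ext (mrdp_ex (P := fun v x => Nat.pair (b v) x = a v)
      (eq_dioph (mrdp_pair (mrdp_some hb) mrdp_none) (mrdp_some ha))) fun v => ?_
    simp only [Set.mem_ofPred_eq, PFun.coe_val, Part.mem_some_iff]
    constructor
    · rintro ⟨x, hx⟩; rw [← hx]; simp
    · intro h; exact ⟨(a v).unpair.2, by rw [h]; simp⟩
  | right =>
    intro α a b ha hb
    refine Dioph.ext (mrdp_ex (P := fun v x => Nat.pair x (b v) = a v)
      (eq_dioph (mrdp_pair mrdp_none (mrdp_some hb)) (mrdp_some ha))) fun v => ?_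
    simp only [Set.mem_ofPred_eq, PFun.coe_val, Part.mem_some_iff]
    constructor
    · rintro ⟨x, hx⟩; rw [← hx]; simp
    · intro h; exact ⟨(a v).unpair.1, by rw [h]; simp⟩
  | @pair f g _ _ ihf ihg =>
    intro α a b ha hb
    refine Dioph.ext (mrdp_ex (P := fun v x => ∃ y, (x ∈ f (a v) ∧ y ∈ g (a v)) ∧ Nat.pair x y = b v)
      (mrdp_ex (P := fun v y => (v none ∈ f (a (v ∘ some)) ∧ y ∈ g (a (v ∘ some))) ∧
        Nat.pair (v none) y = b (v ∘ some))
        (mrdp_and (mrdp_and (ihf (mrdp_some (mrdp_some ha)) (mrdp_some mrdp_none))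
          (ihg (mrdp_some (mrdp_some ha)) mrdp_none))
          (eq_dioph (mrdp_pair (mrdp_some mrdp_none) mrdp_none) (mrdp_some (mrdp_some hb))))))
      fun v => ?_
    simp only [Set.mem_ofPred_eq]
    simp [Seq.seq, and_assoc, eq_comm]
  | @comp f g _ _ ihf ihg =>
    intro α a b ha hb
    refine Dioph.ext (mrdp_ex (P := fun v x => x ∈ g (a v) ∧ b v ∈ f x)
      (mrdp_and (ihg (mrdp_some ha) mrdp_none) (ihf mrdp_none (mrdp_some hb)))) fun v => ?_
    exact Part.mem_bind_iff.symm
  | @prec f g _ _ ihf ihg =>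
    intro α a b ha hb
    have key : ∀ {α : Type} {a n b x y : (α → ℕ) → ℕ}, DiophFn a → DiophFn n → DiophFn b →
        DiophFn x → DiophFn y → Dioph {v | x v % ((0 + 1) * y v + 1) ∈ f (a v) ∧
        (∀ k < n v, x v % ((k + 1 + 1) * y v + 1) ∈
          g (Nat.pair (a v) (Nat.pair k (x v % ((k + 1) * y v + 1))))) ∧
          x v % ((n v + 1) * y v + 1) = b v} := by
      intro α a n b x y ha hn hb hx hy
      have hm : ∀ {α : Type} {k x y : (α → ℕ) → ℕ}, DiophFn k → DiophFn x → DiophFn y →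
          DiophFn (fun v => x v % ((k v + 1) * y v + 1)) := fun hk hx hy =>
        mod_dioph hx (add_dioph (mul_dioph (add_dioph hk (mrdp_const 1)) hy) (mrdp_const 1))
      refine mrdp_and (ihf ha (hm (mrdp_const 0) hx hy)) (mrdp_and ?_ (eq_dioph (hm hn hx hy) hb))
      refine mrdp_ball (P := fun v k => x v % ((k + 1 + 1) * y v + 1) ∈
          g (Nat.pair (a v) (Nat.pair k (x v % ((k + 1) * y v + 1))))) ?_ hn
      exact ihg (mrdp_pair (mrdp_some ha) (mrdp_pair mrdp_none
        (hm mrdp_none (mrdp_some hx) (mrdp_some hy))))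
        (hm (add_dioph mrdp_none (mrdp_const 1)) (mrdp_some hx) (mrdp_some hy))
    have key2 : ∀ {α : Type} {a n b : (α → ℕ) → ℕ}, DiophFn a → DiophFn n → DiophFn b →
        Dioph {v | b v ∈ (Nat.rec (f (a v))
          (fun y IH => do let i ← IH; g (Nat.pair (a v) (Nat.pair y i))) (n v) : Part ℕ)} := by
      intro α a n b ha hn hb
      simp only [mrdp_rec_iff']
      refine mrdp_ex (P := fun v x => ∃ y, x % ((0 + 1) * y + 1) ∈ f (a v) ∧
        (∀ k < n v, x % ((k + 1 + 1) * y + 1) ∈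
          g (Nat.pair (a v) (Nat.pair k (x % ((k + 1) * y + 1))))) ∧
          x % ((n v + 1) * y + 1) = b v) ?_
      refine mrdp_ex (P := fun v y => v none % ((0 + 1) * y + 1) ∈ f (a (v ∘ some)) ∧
        (∀ k < n (v ∘ some), v none % ((k + 1 + 1) * y + 1) ∈
          g (Nat.pair (a (v ∘ some)) (Nat.pair k (v none % ((k + 1) * y + 1))))) ∧
          v none % ((n (v ∘ some) + 1) * y + 1) = b (v ∘ some)) ?_
      exact key (mrdp_some (mrdp_some ha)) (mrdp_some (mrdp_some hn)) (mrdp_some (mrdp_some hb))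
        (mrdp_some mrdp_none) mrdp_none
    have hl : DiophFn (fun v => (a v).unpair.1) := by
      have ha' := mrdp_some ha
      refine Dioph.ext (mrdp_ex (P := fun (v : Option α → ℕ) x =>
          Nat.pair (v none) x = a (v ∘ some))
        (eq_dioph (mrdp_pair (mrdp_some mrdp_none) mrdp_none) (mrdp_some ha'))) fun v => ?_
      simp only [Set.mem_ofPred_eq]
      constructor
      · rintro ⟨x, hx⟩; rw [← hx]; simp
      · intro h; exact ⟨(a (v ∘ some)).unpair.2, by rw [← h]; simp⟩
    have hr : DiophFn (fun v => (a v).unpair.2) := by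
      have ha' := mrdp_some ha
      refine Dioph.ext (mrdp_ex (P := fun (v : Option α → ℕ) x =>
          Nat.pair x (v none) = a (v ∘ some))
        (eq_dioph (mrdp_pair mrdp_none (mrdp_some mrdp_none)) (mrdp_some ha'))) fun v => ?_
      simp only [Set.mem_ofPred_eq]
      constructor
      · rintro ⟨x, hx⟩; rw [← hx]; simp
      · intro h; exact ⟨(a (v ∘ some)).unpair.1, by rw [← h]; simp⟩
    exact key2 hl hr hb
  | @rfind f _ ih =>
    intro α a b ha hb
    have h1 := ih (mrdp_pair ha hb) (mrdp_const (α := α) 0)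
    have h2 := mrdp_ball (P := fun v k => ∃ x, x ∈ f (Nat.pair (a v) k) ∧ x ≠ 0)
      (mrdp_ex (P := fun v x => x ∈ f (Nat.pair (a (v ∘ some)) (v none)) ∧ x ≠ 0)
        (mrdp_and (ih (mrdp_pair (mrdp_some (mrdp_some ha)) (mrdp_some mrdp_none)) mrdp_none)
          (ne_dioph mrdp_none (mrdp_const 0)))) hb
    refine Dioph.ext (mrdp_and h1 h2) fun v => ?_
    refine Iff.trans ?_ Nat.mem_rfind.symm
    simp

/-- There is a fixed polynomial for the halting problem. -/
theorem mrdp_halting : ∃ (β : Type) (_ : Fintype β) (p : Poly (Unit ⊕ β)), ∀ n : ℕ,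
    ((Denumerable.ofNat Nat.Partrec.Code n).eval 0).Dom ↔
      ∃ t, p (Sum.elim (fun _ => n) t) = 0 := by
  have h0 : Partrec (fun n : ℕ => (Denumerable.ofNat Nat.Partrec.Code n).eval 0) :=
    Nat.Partrec.Code.eval_part.comp (Computable.ofNat _) (Computable.const 0)
  have h1 := mrdp_partrec (Partrec.nat_iff.1 h0)
    (mrdp_some (proj_dioph ())) (mrdp_none (α := Unit))
  obtain ⟨β, i, p, hp⟩ := mrdp_finite (mrdp_ex (P := fun (v : Unit → ℕ) x =>
    x ∈ (Denumerable.ofNat Nat.Partrec.Code (v ())).eval 0) h1)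
  refine ⟨β, i, p, fun n => ?_⟩
  rw [← hp]
  simp [Part.dom_iff_mem]

end MRDP

/- ===== Part 3: the reduction ===== -/

section Reduction

variable {F : ℕ → List ℤ → ℤ} {R : ℕ → List ℤ → Bool}

theorem red_eval2 (f : ℕ) (ρ : ℕ → ℤ) (a b : Tm ℤ) :
    (Tm.func f [a, b]).eval F ρ = F f [a.eval F ρ, b.eval F ρ] := by
  simp [Tm.eval]

theorem red_fv2 (f : ℕ) (a b : Tm ℤ) : (Tm.func f [a, b]).fv = a.fv ++ b.fv := by
  simp [Tm.fv]

/-- square of a variable -/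
def redSq (x : ℕ) : Tm ℤ := .func 1 [.var x, .var x]

/-- sum of four squares -/
def redVar (i : ℕ) : Tm ℤ :=
  .func 0 [.func 0 [redSq (4 * i), redSq (4 * i + 1)],
    .func 0 [redSq (4 * i + 2), redSq (4 * i + 3)]]

/-- value of the sum of four squares -/
def redVal (ρ : ℕ → ℤ) (i : ℕ) : ℕ :=
  ((ρ (4 * i)) ^ 2 + (ρ (4 * i + 1)) ^ 2 + ((ρ (4 * i + 2)) ^ 2 + (ρ (4 * i + 3)) ^ 2)).toNat

theorem redVar_eval (hadd : ∀ a b : ℤ, F 0 [a, b] = a + b) (hmul : ∀ a b : ℤ, F 1 [a, b] = a * b)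
    (ρ : ℕ → ℤ) (i : ℕ) : (redVar i).eval F ρ = redVal ρ i := by
  rw [redVal, Int.toNat_of_nonneg (by positivity)]
  simp only [redVar, redSq, red_eval2, hadd, hmul]
  simp only [Tm.eval]
  ring

theorem redVar_fv (m i : ℕ) (hi : i < m) : ∀ x ∈ (redVar i).fv, x < 4 * m := by
  intro x hx
  simp only [redVar, redSq, red_fv2] at hx
  simp only [Tm.fv] at hx
  simp at hx
  omega

theorem red_poly (hadd : ∀ a b : ℤ, F 0 [a, b] = a + b) (hmul : ∀ a b : ℤ, F 1 [a, b] = a * b)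
    {γ : Type} (m : ℕ) (e : γ → Fin m) {f : (γ → ℕ) → ℤ} (hf : IsPoly f) :
    ∃ T : Tm ℤ, (∀ ρ, T.eval F ρ = f (fun i => redVal ρ (e i))) ∧ ∀ x ∈ T.fv, x < 4 * m := by
  induction hf with
  | proj i => exact ⟨redVar (e i), fun ρ => redVar_eval hadd hmul ρ _, redVar_fv m _ (e i).2⟩
  | const n => exact ⟨.const n, fun ρ => by simp [Tm.eval], by simp [Tm.fv]⟩
  | sub _ _ ih1 ih2 =>
    obtain ⟨A, hA, hA'⟩ := ih1
    obtain ⟨B, hB, hB'⟩ := ih2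
    refine ⟨.func 0 [A, .func 1 [.const (-1), B]], fun ρ => ?_, ?_⟩
    · simp only [red_eval2, hadd, hmul, hA, hB]
      simp only [Tm.eval]
      ring
    · intro x hx
      simp only [red_fv2, List.mem_append] at hx
      simp only [Tm.fv] at hx
      rcases hx with hx | hx | hx
      exacts [hA' x hx, by simp at hx, hB' x hx]
  | mul _ _ ih1 ih2 =>
    obtain ⟨A, hA, hA'⟩ := ih1
    obtain ⟨B, hB, hB'⟩ := ih2
    refine ⟨.func 1 [A, B], fun ρ => ?_, ?_⟩
    · simp only [red_eval2, hmul, hA, hB]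
    · intro x hx
      simp only [red_fv2, List.mem_append] at hx
      rcases hx with hx | hx
      exacts [hA' x hx, hB' x hx]

theorem redVal_surj (m : ℕ) (t : ℕ → ℕ) : ∃ ρ : ℕ → ℤ, ∀ i, redVal ρ i = t i := by
  have h := fun i => Nat.sum_four_squares (t i)
  choose a b c d h using h
  refine ⟨fun x => if x % 4 = 0 then a (x / 4) else if x % 4 = 1 then b (x / 4) else
    if x % 4 = 2 then c (x / 4) else d (x / 4), fun i => ?_⟩
  have e0 : 4 * i % 4 = 0 := by omega
  have e1 : (4 * i + 1) % 4 = 1 := by omega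
  have e2 : (4 * i + 2) % 4 = 2 := by omega
  have e3 : (4 * i + 3) % 4 = 3 := by omega
  have f0 : 4 * i / 4 = i := by omega
  have f1 : (4 * i + 1) / 4 = i := by omega
  have f2 : (4 * i + 2) / 4 = i := by omega
  have f3 : (4 * i + 3) / 4 = i := by omega
  simp only [redVal, e0, e1, e2, e3, f0, f1, f2, f3]
  rw [← h i]
  norm_num
  have : ((a i : ℤ) ^ 2 + b i ^ 2 + (c i ^ 2 + d i ^ 2))
    = ((a i ^ 2 + b i ^ 2 + c i ^ 2 + d i ^ 2 : ℕ) : ℤ) := by push_cast; ring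
  rw [this, Int.toNat_natCast]

theorem red_lookup (σ : ℕ → ℤ) (v : ℕ) : ∀ l : List ℕ, v ∈ l →
    (l.zip (l.map σ)).lookup v = some (σ v) := by
  intro l
  induction l with
  | nil => simp
  | cons x l ih =>
    intro h
    simp only [List.map_cons, List.zip_cons_cons, List.lookup_cons]
    by_cases hx : v = x
    · subst hx; simp
    · have : (v == x) = false := by simpa using hx
      rw [this]
      exact ih (by simpa [hx] using h)

/-- the po-history -/
def redHist (m : ℕ) : PoHistory ℤ := [{(0, (List.range (4 * m)).map Sum.inl)}]

/-- the formula -/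
def redFm (m : ℕ) (X T : Tm ℤ) (n : ℕ) : Fm ℤ :=
  .not (.all (List.range (4 * m)) 0 (.not (.and (.rel 0 [X, .const (n : ℤ)])
    (.rel 0 [T, .const 0]))))

theorem red_potsat (heq : ∀ a b : ℤ, R 0 [a, b] = true ↔ a = b) (m : ℕ) (X T : Tm ℤ) (n : ℕ) :
    PotSat F R (redHist m) 1 (redFm m X T n) ↔
      ∃ σ : ℕ → ℤ, ∀ ρ : ℕ → ℤ,
        X.eval F (updEnv ρ (List.range (4 * m)) ((List.range (4 * m)).map σ)) = n ∧
        T.eval F (updEnv ρ (List.range (4 * m)) ((List.range (4 * m)).map σ)) = 0 := by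
  refine exists_congr fun σ => forall_congr' fun ρ => ?_
  simp only [redFm, Sat, redHist, applySub]
  simp [heq, Tm.eval, Function.comp_def]

theorem red_closed (m : ℕ) (X T : Tm ℤ) (n : ℕ) (hX : ∀ x ∈ X.fv, x < 4 * m)
    (hT : ∀ x ∈ T.fv, x < 4 * m) : (redFm m X T n).Closed := by
  simp only [Fm.Closed, redFm, Fm.fv]
  rw [List.filter_eq_nil_iff]
  intro x hx
  simp [Tm.fv] at hx
  simp
  rcases hx with hx | hx
  exacts [hX x hx, hT x hx]

theorem red_computable (m : ℕ) (X T : Tm ℤ) : Computable (fun n => (redFm m X T n).enc) := by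
  simp only [redFm, Fm.enc, List.map_cons, List.map_nil]
  simp only [Tm.enc]
  have hint : ∀ n : ℕ, Encodable.encode (n : ℤ) = 2 * n := fun n => rfl
  simp only [hint]
  have hp : ∀ (c : ℕ) {g : ℕ → ℕ}, Primrec g → Primrec (fun n => Nat.pair c (g n)) :=
    fun c g hg => Primrec₂.natPair.comp (Primrec.const c) hg
  have hp' : ∀ (c : ℕ) {g : ℕ → ℕ}, Primrec g → Primrec (fun n => Nat.pair (g n) c) :=
    fun c g hg => Primrec₂.natPair.comp hg (Primrec.const c)
  apply Primrec.to_comp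
  refine hp _ (hp _ (hp _ (hp _ (hp _ (hp _ (hp' _ (hp _ (hp _ ?_))))))))
  refine Primrec.encode.comp (Primrec.list_cons.comp (Primrec.const _)
    (Primrec.list_cons.comp (hp _ ?_) (Primrec.const _)))
  exact Primrec.nat_mul.comp (Primrec.const 2) Primrec.id

end Reduction

/-- Over ℤ with polynomial arithmetic (`+` is function symbol `0`,
`×` is function symbol `1`, `=` is relation symbol `0`), the potential satisfiability
problem is undecidable: there is no computable function which, given (the natural
encodings of) a po-history `h`, an index `i` with `1 ≤ i ≤ |h|`, and a closed formula
`ψ`, returns `true` if `(h,i) ⊢ ψ` and `false` otherwise. -/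
theorem potsat_undecidable (F : ℕ → List ℤ → ℤ) (R : ℕ → List ℤ → Bool)
    (hadd : ∀ a b : ℤ, F 0 [a, b] = a + b) (hmul : ∀ a b : ℤ, F 1 [a, b] = a * b)
    (heq : ∀ a b : ℤ, R 0 [a, b] = true ↔ a = b) :
    ¬ ∃ f : ℕ → Bool, Computable f ∧
        ∀ (h : PoHistory ℤ) (i : ℕ) (ψ : Fm ℤ), 1 ≤ i → i ≤ h.length → ψ.Closed →
          (f (Nat.pair (Encodable.encode h) (Nat.pair i ψ.enc)) = true ↔
            PotSat F R h i ψ) := by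
  rintro ⟨f, hf, hspec⟩
  obtain ⟨β, _, p, hp⟩ := mrdp_halting
  let m := Fintype.card (Unit ⊕ β)
  let e : Unit ⊕ β ≃ Fin m := Fintype.equivFin _
  obtain ⟨T, hT, hTfv⟩ := red_poly hadd hmul m e p.isPoly
  let X := redVar (e (Sum.inl ()))
  have hX : ∀ ρ, X.eval F ρ = redVal ρ (e (Sum.inl ())) := fun ρ => redVar_eval hadd hmul ρ _
  have hXfv : ∀ x ∈ X.fv, x < 4 * m := redVar_fv m _ (e (Sum.inl ())).2
  have hval : ∀ (σ ρ : ℕ → ℤ) (i : Fin m),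
      redVal (updEnv ρ (List.range (4 * m)) ((List.range (4 * m)).map σ)) i = redVal σ i := by
    intro σ ρ i
    have hi := i.2
    have hu : ∀ x < 4 * m,
        updEnv ρ (List.range (4 * m)) ((List.range (4 * m)).map σ) x = σ x := fun x hx => by
      rw [updEnv, red_lookup σ x _ (List.mem_range.2 hx)]; rfl
    simp only [redVal]
    rw [hu _ (by omega), hu _ (by omega), hu _ (by omega), hu _ (by omega)]
  have hiff : ∀ n : ℕ, PotSat F R (redHist m) 1 (redFm m X T n) ↔
      ((Denumerable.ofNat Nat.Partrec.Code n).eval 0).Dom := by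
    intro n
    rw [red_potsat heq, hp]
    simp only [hX, hT, hval]
    constructor
    · rintro ⟨σ, h⟩
      obtain ⟨h1, h2⟩ := h 0
      refine ⟨fun b => redVal σ (e (Sum.inr b)), ?_⟩
      rw [← h2]
      congr 1
      funext i
      rcases i with i | i
      · exact_mod_cast h1.symm
      · rfl
    · rintro ⟨t, ht⟩
      obtain ⟨σ, hσ⟩ := redVal_surj m
        (fun j => if h : j < m then Sum.elim (fun _ => n) t (e.symm ⟨j, h⟩) else 0)
      have hσ' : ∀ i, redVal σ (e i) = Sum.elim (fun _ => n) t i := fun i => by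
        rw [hσ]; simp
      refine ⟨σ, fun _ => ⟨?_, ?_⟩⟩
      · rw [hσ']; rfl
      · rw [← ht]
        congr 1
        funext i
        exact hσ' i
  have hcomp : Computable (fun n : ℕ => f (Nat.pair (Encodable.encode (redHist m))
      (Nat.pair 1 (redFm m X T n).enc))) :=
    hf.comp (Primrec₂.natPair.to_comp.comp (Computable.const _)
      (Primrec₂.natPair.to_comp.comp (Computable.const _) (red_computable m X T)))
  refine ComputablePred.halting_problem 0 (ComputablePred.computable_iff.2
    ⟨fun c => f (Nat.pair (Encodable.encode (redHist m))
      (Nat.pair 1 (redFm m X T (Encodable.encode c)).enc)),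
      hcomp.comp Computable.encode, ?_⟩)
  funext c
  have h1 := hspec (redHist m) 1 (redFm m X T (Encodable.encode c)) le_rfl (by simp [redHist])
    (red_closed m X T _ hXfv hTfv)
  have h2 := hiff (Encodable.encode c)
  rw [Denumerable.ofNat_encode] at h2
  exact propext (h1.trans h2).symm
end
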